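/- Suppose b = 1, A_1 = I_d (Assumption (A5)), Assumption (A0) holds, and U_1 : ℝ^d → ℝ is twice continuously differentiable, M_1-smooth and m_1-strongly convex with 0 < m_1 ≤ M_1 (Assumptions (A2) and (A4)). Let θ* be the unique minimizer of U_1 and let 0 < ε ≤ 1. Choose ρ² = max(ε²/(4m_1), ε/√(m_1 M_1)). Then for every integer t ≥ log(3/ε)/log(1 + max(ε²/4, ε√(m_1/M_1))), the t-step distribution of the Split Gibbs Sampler started at the Dirac mass δ_{θ*} satisfies W_1(δ_{θ*}P_SGS^t, π) ≤ ε·√(d/m_1), where W_1 is the 1-Wasserstein distance for the Euclidean metric and π(θ) ∝ exp(−U_1(θ)). -/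

import Mathlib

/-!
STATEMENT 2: Complexity bound in 1-Wasserstein distance for SGS with single
splitting (b = 1, A₁ = I_d). With ρ² = max(ε²/(4m₁), ε/√(m₁M₁)) and
t ≥ log(3/ε)/log(1 + max(ε²/4, ε√(m₁/M₁))), starting from δ_{θ*},
W₁(δ_{θ*}P_SGS^t, π) ≤ ε√(d/m₁).
-/

open MeasureTheory
open scoped ENNReal RealInnerProductSpace

noncomputable section

abbrev EV (n : ℕ) := EuclideanSpace ℝ (Fin n)

/-- Probability measure with (unnormalized) density `f` w.r.t. the volume measure. -/
def densMeasure {α : Type*} [MeasureSpace α] (f : α → ℝ) : Measure α :=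
  (∫⁻ x, ENNReal.ofReal (f x))⁻¹ • (volume.withDensity fun x => ENNReal.ofReal (f x))

def IsCoupling {α : Type*} [MeasurableSpace α] (γ : Measure (α × α)) (μ ν : Measure α) : Prop :=
  γ.map Prod.fst = μ ∧ γ.map Prod.snd = ν

/-- Wasserstein distance of order `p` w.r.t. the metric `w`. -/
def Wp {α : Type*} [MeasurableSpace α] (p : ℝ) (w : α → α → ℝ) (μ ν : Measure α) : ℝ :=
  sInf {r | ∃ γ : Measure (α × α), IsCoupling γ μ ν ∧
    r = (∫ x, w x.1 x.2 ^ p ∂γ) ^ (1 / p)}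

/-- Distribution after `t` steps of the Markov transition `P` started from `ν`. -/
def iterDist {α : Type*} [MeasurableSpace α] (P : α → Measure α) (ν : Measure α) : ℕ → Measure α
  | 0 => ν
  | t + 1 => (iterDist P ν t).bind P

/-- SGS transition kernel for single splitting with A₁ = I_d: draw z from the
density ∝ exp(−U(z) − ‖z−θ‖²/(2ρ²)), then draw θ' from N(z, ρ²I_d). -/
def sgsKernelId {n : ℕ} (U : EV n → ℝ) (ρ : ℝ) (θ : EV n) : Measure (EV n) :=
  (densMeasure fun z : EV n => Real.exp (-U z - ‖z - θ‖ ^ 2 / (2 * ρ ^ 2))).bind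
    fun z => densMeasure fun θ' : EV n => Real.exp (-(‖θ' - z‖ ^ 2 / (2 * ρ ^ 2)))

section PartA
open MeasureTheory
open scoped ENNReal RealInnerProductSpace

theorem bm_compact (K L S : Set ℝ) (hK : IsCompact K) (hL : IsCompact L)
    (hKn : K.Nonempty) (hLn : L.Nonempty) (h : ∀ x ∈ K, ∀ y ∈ L, x + y ∈ S) :
    volume K + volume L ≤ volume S := by
  obtain ⟨a, haK, ha⟩ := hK.exists_isGreatest hKn
  obtain ⟨b, hbL, hb⟩ := hL.exists_isLeast hLn
  have h1 : volume ((fun x => x + b) '' K) = volume K := by simp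
  have h2 : volume ((fun x => a + x) '' L) = volume L := by simp
  rw [← h1, ← h2, ← measure_union₀]
  · apply measure_mono
    rintro _ (⟨x, hx, rfl⟩ | ⟨y, hy, rfl⟩)
    · exact h x hx b hbL
    · exact h a haK y hy
  · exact ((hL.image (by fun_prop)).measurableSet).nullMeasurableSet
  · refine measure_mono_null (t := {a + b}) ?_ (by simp)
    rintro z ⟨⟨x, hx, rfl⟩, ⟨y, hy, hxy⟩⟩
    have := ha hx
    have := hb hy
    simp only [Set.mem_singleton_iff] at *
    linarith

theorem bm_meas (A B S : Set ℝ) (hA : MeasurableSet A) (hB : MeasurableSet B)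
    (hAn : A.Nonempty) (hBn : B.Nonempty) (h : ∀ x ∈ A, ∀ y ∈ B, x + y ∈ S) :
    volume A + volume B ≤ volume S := by
  obtain ⟨a, ha⟩ := hAn
  obtain ⟨b, hb⟩ := hBn
  by_cases hA0 : volume A = 0
  · rw [hA0, zero_add]
    have h2 : volume ((fun x => a + x) '' B) = volume B := by simp
    rw [← h2]
    apply measure_mono
    rintro _ ⟨y, hy, rfl⟩
    exact h a ha y hy
  by_cases hB0 : volume B = 0
  · rw [hB0, add_zero]
    have h2 : volume ((fun x => x + b) '' A) = volume A := by simp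
    rw [← h2]
    apply measure_mono
    rintro _ ⟨y, hy, rfl⟩
    exact h y hy b hb
  by_contra! hlt
  obtain ⟨p, hp, q, hq, hpq⟩ := ENNReal.exists_lt_add_of_lt_add hlt hA0 hB0
  obtain ⟨K, hKA, hK, hpK⟩ := hA.exists_lt_isCompact hp
  obtain ⟨L, hLB, hL, hqL⟩ := hB.exists_lt_isCompact hq
  have hKn : K.Nonempty := by
    rw [Set.nonempty_iff_ne_empty]; rintro rfl; simp at hpK
  have hLn : L.Nonempty := by
    rw [Set.nonempty_iff_ne_empty]; rintro rfl; simp at hqL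
  have := bm_compact K L S hK hL hKn hLn (fun x hx y hy => h x (hKA hx) y (hLB hy))
  exact absurd (hpq.trans_le ((add_le_add hpK.le hqL.le).trans this)) (lt_irrefl _)

theorem layer_cake (u : ℝ → ℝ≥0∞) (hu : Measurable u) (h1 : ∀ x, u x ≤ 1) :
    ∫⁻ x, u x = ∫⁻ t in Set.Ioi (0:ℝ), volume {x | ENNReal.ofReal t < u x} := by
  have h := lintegral_eq_lintegral_meas_lt (volume : Measure ℝ) (f := fun x => (u x).toReal)
    (by filter_upwards with x; positivity) (by fun_prop)
  have e1 : ∀ x, ENNReal.ofReal (u x).toReal = u x := fun x =>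
    ENNReal.ofReal_toReal ((h1 x).trans_lt (by simp)).ne
  simp only [e1] at h
  rw [h]
  apply setLIntegral_congr_fun measurableSet_Ioi
  intro t ht
  dsimp
  congr 1
  ext x
  simp only [Set.mem_ofPred_eq]
  rw [ENNReal.ofReal_lt_iff_lt_toReal (le_of_lt ht) ((h1 x).trans_lt (by simp)).ne]

theorem pl_one_norm (u v w : ℝ → ℝ≥0∞) (hu : Measurable u) (hv : Measurable v)
    (hw : Measurable w) (hu1 : ∀ x, u x ≤ 1) (hv1 : ∀ x, v x ≤ 1)
    (hus : ∀ t < 1, ∃ x, t < u x) (hvs : ∀ t < 1, ∃ x, t < v x)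
    (h : ∀ x y, u x * v y ≤ w ((1/2:ℝ) • (x + y)) ^ 2) :
    (∫⁻ x, u x) + ∫⁻ x, v x ≤ 2 * ∫⁻ x, w x := by
  let w' : ℝ → ℝ≥0∞ := fun x => min (w x) 1
  have hw' : Measurable w' := hw.min measurable_const
  have hle : ∫⁻ x, w' x ≤ ∫⁻ x, w x := lintegral_mono fun x => min_le_left _ _
  refine le_trans ?_ (mul_le_mul_right hle 2)
  have hw'1 : ∀ x, w' x ≤ 1 := fun x => min_le_right _ _
  rw [layer_cake u hu hu1, layer_cake v hv hv1, layer_cake w' hw' hw'1]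
  have hmeas : ∀ f : ℝ → ℝ≥0∞, Measurable fun t : ℝ => volume {x | ENNReal.ofReal t < f x} := by
    intro f
    apply Antitone.measurable
    intro s t hst
    apply measure_mono
    intro x hx
    exact lt_of_le_of_lt (ENNReal.ofReal_le_ofReal hst) hx
  rw [← lintegral_add_left (hmeas _), ← lintegral_const_mul _ (hmeas _)]
  apply setLIntegral_mono' measurableSet_Ioi
  intro t ht
  by_cases ht1 : ENNReal.ofReal t < 1
  · have hS : volume {s : ℝ | ENNReal.ofReal t < w' ((1/2:ℝ) * s)}
        = 2 * volume {x | ENNReal.ofReal t < w' x} := by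
      have := Real.volume_preimage_mul_left (a := (1/2:ℝ)) (by norm_num)
        {x | ENNReal.ofReal t < w' x}
      simp only [Set.preimage_ofPred_eq] at this
      rw [this]
      congr 1
      norm_num
    rw [← hS]
    apply bm_meas
    · exact measurableSet_lt measurable_const hu
    · exact measurableSet_lt measurable_const hv
    · exact hus _ ht1
    · exact hvs _ ht1
    · intro x hx y hy
      simp only [Set.mem_ofPred_eq] at *
      refine lt_min ?_ ht1
      by_contra! hcon
      have h3 := h x y
      rw [smul_eq_mul] at h3
      have h4 : ENNReal.ofReal t * ENNReal.ofReal t < u x * v y := ENNReal.mul_lt_mul hx hy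
      have h5 : w ((1/2:ℝ) * (x + y)) ^ 2 ≤ ENNReal.ofReal t ^ 2 := by gcongr
      rw [sq (ENNReal.ofReal t)] at h5
      exact absurd (h4.trans_le (h3.trans h5)) (lt_irrefl _)
  · have e1 : {x | ENNReal.ofReal t < u x} = ∅ := by
      ext x; simp only [Set.mem_ofPred_eq, Set.mem_empty_iff_false, iff_false, not_lt]
      exact (hu1 x).trans (not_lt.1 ht1)
    have e2 : {x | ENNReal.ofReal t < v x} = ∅ := by
      ext x; simp only [Set.mem_ofPred_eq, Set.mem_empty_iff_false, iff_false, not_lt]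
      exact (hv1 x).trans (not_lt.1 ht1)
    simp [e1, e2]

theorem ennreal_amgm (a b : ℝ≥0∞) : 4 * (a * b) ≤ (a + b) ^ 2 := by
  by_cases ha : a = ⊤
  · subst ha; simp
  by_cases hb : b = ⊤
  · subst hb; simp
  lift a to NNReal using ha
  lift b to NNReal using hb
  norm_cast
  rw [← NNReal.coe_le_coe]
  push_cast
  nlinarith [sq_nonneg ((a:ℝ) - b)]

theorem pl_one_bdd (u v w : ℝ → ℝ≥0∞) (hu : Measurable u) (hv : Measurable v)
    (hw : Measurable w) (n : ℝ≥0∞) (hn : n ≠ ⊤) (hu1 : ∀ x, u x ≤ n) (hv1 : ∀ x, v x ≤ n)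
    (h : ∀ x y, u x * v y ≤ w ((1/2:ℝ) • (x + y)) ^ 2) :
    (∫⁻ x, u x) * ∫⁻ x, v x ≤ (∫⁻ x, w x) ^ 2 := by
  set a := ⨆ x, u x with ha
  set b := ⨆ x, v x with hb
  have hat : a ≠ ⊤ := ((iSup_le hu1).trans_lt hn.lt_top).ne
  have hbt : b ≠ ⊤ := ((iSup_le hv1).trans_lt hn.lt_top).ne
  have hua : ∀ x, u x ≤ a := fun x => le_iSup u x
  have hvb : ∀ x, v x ≤ b := fun x => le_iSup v x
  by_cases ha0 : a = 0
  · have : ∀ x, u x = 0 := fun x => le_antisymm ((hua x).trans ha0.le) bot_le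
    simp [this]
  by_cases hb0 : b = 0
  · have : ∀ x, v x = 0 := fun x => le_antisymm ((hvb x).trans hb0.le) bot_le
    simp [this]
  set c : ℝ≥0∞ := (a * b) ^ (1/2 : ℝ) with hc
  have hc2 : c ^ 2 = a * b := by
    rw [hc, ← ENNReal.rpow_natCast, ← ENNReal.rpow_mul]; norm_num
  have hab0 : a * b ≠ 0 := mul_ne_zero ha0 hb0
  have habt : a * b ≠ ⊤ := ENNReal.mul_ne_top hat hbt
  have hc0 : c ≠ 0 := by rintro h0; rw [h0] at hc2; simp at hc2; tauto
  have hct : c ≠ ⊤ := by rintro h0; rw [h0] at hc2; simp at hc2; exact habt hc2.symm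
  have sup : ∀ (f : ℝ → ℝ≥0∞) (s : ℝ≥0∞), s = ⨆ x, f x → s ≠ 0 → s ≠ ⊤ →
      ∀ t < 1, ∃ x, t < s⁻¹ * f x := by
    intro f s hs h0 h1 t ht
    have : s * t < ⨆ x, f x := by
      rw [← hs]
      calc s * t < s * 1 := by
            exact ENNReal.mul_lt_mul_right h0 h1 ht
        _ = s := mul_one s
    obtain ⟨x, hx⟩ := lt_iSup_iff.1 this
    refine ⟨x, ?_⟩
    calc t = s⁻¹ * (s * t) := by rw [← mul_assoc, ENNReal.inv_mul_cancel h0 h1, one_mul]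
      _ < s⁻¹ * f x := ENNReal.mul_lt_mul_right (ENNReal.inv_ne_zero.2 h1) (ENNReal.inv_ne_top.2 h0) hx
  have key := pl_one_norm (fun x => a⁻¹ * u x) (fun x => b⁻¹ * v x) (fun x => c⁻¹ * w x)
    (hu.const_mul _) (hv.const_mul _) (hw.const_mul _)
    (fun x => by
      calc a⁻¹ * u x ≤ a⁻¹ * a := by gcongr; exact hua x
        _ = 1 := ENNReal.inv_mul_cancel ha0 hat)
    (fun x => by
      calc b⁻¹ * v x ≤ b⁻¹ * b := by gcongr; exact hvb x
        _ = 1 := ENNReal.inv_mul_cancel hb0 hbt)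
    (sup u a ha ha0 hat) (sup v b hb hb0 hbt)
    (fun x y => by
      rw [mul_pow, ← ENNReal.inv_pow, hc2, ENNReal.mul_inv (Or.inl ha0) (Or.inl hat)]
      calc a⁻¹ * u x * (b⁻¹ * v y) = a⁻¹ * b⁻¹ * (u x * v y) := by ring
        _ ≤ _ := by gcongr; exact h x y)
  rw [lintegral_const_mul _ hu, lintegral_const_mul _ hv, lintegral_const_mul _ hw] at key
  set I := ∫⁻ x, u x
  set J := ∫⁻ x, v x
  set W := ∫⁻ x, w x
  have h4 : 4 * (I * J) ≤ 4 * W ^ 2 := by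
    calc 4 * (I * J) = (a * a⁻¹) * (b * b⁻¹) * (4 * (I * J)) := by
          rw [ENNReal.mul_inv_cancel ha0 hat, ENNReal.mul_inv_cancel hb0 hbt]; ring
      _ = c ^ 2 * (4 * ((a⁻¹ * I) * (b⁻¹ * J))) := by rw [hc2]; ring
      _ ≤ c ^ 2 * (a⁻¹ * I + b⁻¹ * J) ^ 2 := by gcongr; exact ennreal_amgm _ _
      _ ≤ c ^ 2 * (2 * (c⁻¹ * W)) ^ 2 := by gcongr
      _ = 4 * (c * c⁻¹) ^ 2 * W ^ 2 := by ring
      _ = 4 * W ^ 2 := by rw [ENNReal.mul_inv_cancel hc0 hct]; ring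
  exact (ENNReal.mul_le_mul_iff_right (by norm_num) (by norm_num)).1 h4

/-- Prékopa–Leindler property (midpoint form) of a measure. -/
def PLProp {E : Type*} [AddCommGroup E] [Module ℝ E] [MeasurableSpace E] (μ : Measure E) : Prop :=
  ∀ u v w : E → ℝ≥0∞, Measurable u → Measurable v → Measurable w →
    (∀ x y, u x * v y ≤ w ((1/2:ℝ) • (x + y)) ^ 2) →
    (∫⁻ x, u x ∂μ) * ∫⁻ x, v x ∂μ ≤ (∫⁻ x, w x ∂μ) ^ 2

theorem pl_real : PLProp (volume : Measure ℝ) := by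
  intro u v w hu hv hw h
  have e : ∀ (f : ℝ → ℝ≥0∞), Measurable f →
      ∫⁻ x, f x = ⨆ n : ℕ, ∫⁻ x, min (f x) n := by
    intro f hf
    rw [← lintegral_iSup (fun n => hf.min measurable_const)]
    · congr 1
      ext x
      apply le_antisymm
      · by_cases hx : f x = ⊤
        · simp only [hx]
          simp [ENNReal.iSup_natCast]
        · obtain ⟨n, hn⟩ := ENNReal.exists_nat_gt hx
          exact le_iSup_of_le n (by simp [hn.le])
      · exact iSup_le fun n => min_le_left _ _
    · intro i j hij x
      dsimp
      gcongr
  rw [e u hu, e v hv, ENNReal.iSup_mul]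
  refine iSup_le fun n => ?_
  rw [ENNReal.mul_iSup]
  refine iSup_le fun k => ?_
  apply pl_one_bdd _ _ w (hu.min measurable_const) (hv.min measurable_const) hw (max n k)
    (by simp)
  · intro x; exact (min_le_right _ _).trans (le_max_left _ _)
  · intro x; exact (min_le_right _ _).trans (le_max_right _ _)
  · intro x y
    exact (mul_le_mul' (min_le_left _ _) (min_le_left _ _)).trans (h x y)

theorem pl_prod {E F : Type*} [AddCommGroup E] [Module ℝ E] [MeasurableSpace E]
    [AddCommGroup F] [Module ℝ F] [MeasurableSpace F] (μ : Measure E) (ν : Measure F)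
    [SFinite μ] [SFinite ν] (hμ : PLProp μ) (hν : PLProp ν) : PLProp (μ.prod ν) := by
  intro u v w hu hv hw h
  rw [lintegral_prod _ hu.aemeasurable, lintegral_prod _ hv.aemeasurable,
    lintegral_prod _ hw.aemeasurable]
  apply hμ _ _ _ hu.lintegral_prod_right' hv.lintegral_prod_right' hw.lintegral_prod_right'
  intro x y
  apply hν _ _ _ (hu.comp measurable_prodMk_left) (hv.comp measurable_prodMk_left)
    (hw.comp measurable_prodMk_left)
  intro x' y'
  exact h (x, x') (y, y')

theorem pl_transfer {E F : Type*} [AddCommGroup E] [Module ℝ E] [MeasurableSpace E]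
    [AddCommGroup F] [Module ℝ F] [MeasurableSpace F] (μ : Measure E) (ν : Measure F)
    (e : E → F) (he : MeasurePreserving e μ ν)
    (hlin : ∀ x y, e ((1/2:ℝ) • (x + y)) = (1/2:ℝ) • (e x + e y)) (hμ : PLProp μ) :
    PLProp ν := by
  intro u v w hu hv hw h
  rw [← he.lintegral_comp hu, ← he.lintegral_comp hv, ← he.lintegral_comp hw]
  apply hμ _ _ _ (hu.comp he.measurable) (hv.comp he.measurable) (hw.comp he.measurable)
  intro x y
  simp only [Function.comp]
  rw [hlin]
  exact h _ _

theorem pl_pi (n : ℕ) : PLProp (volume : Measure (Fin n → ℝ)) := by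
  induction n with
  | zero =>
    intro u v w hu hv hw h
    have : (volume : Measure (Fin 0 → ℝ)) = Measure.dirac 0 := by
      rw [volume_pi, Measure.pi_of_empty]
      congr
      exact Subsingleton.elim _ _
    rw [this]
    simp only [lintegral_dirac]
    have := h 0 0
    simpa using this
  | succ n ih =>
    have h1 := pl_prod (volume : Measure ℝ) (volume : Measure (Fin n → ℝ)) pl_real ih
    refine pl_transfer _ _ _ (volume_preserving_piFinSuccAbove (fun _ => ℝ) 0).symm ?_ h1
    intro x y
    ext i
    refine Fin.cases ?_ (fun j => ?_) i <;>
    simp [MeasurableEquiv.piFinSuccAbove] <;> ring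

theorem pl_EV (n : ℕ) : PLProp (volume : Measure (EV n)) :=
  pl_transfer _ _ _ (PiLp.volume_preserving_toLp (Fin n)) (fun x y => by ext i; simp; ring) (pl_pi n)

end PartA

section PartB
open MeasureTheory
open scoped ENNReal RealInnerProductSpace

theorem finite_duality {I J : Type*} [Fintype I] [Fintype J] [DecidableEq I] [DecidableEq J]
    (a : I → ℝ) (b : J → ℝ) (ha : ∀ i, 0 ≤ a i) (hb : ∀ j, 0 ≤ b j)
    (ha1 : ∑ i, a i = 1) (hb1 : ∑ j, b j = 1) (c : I → J → ℝ) (C : ℝ)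
    (H : ∀ (φ : I → ℝ) (ψ : J → ℝ), (∀ i j, φ i - ψ j ≤ c i j) →
      ∑ i, φ i * a i - ∑ j, ψ j * b j ≤ C) :
    ∃ g : I → J → ℝ, (∀ i j, 0 ≤ g i j) ∧ (∀ i, ∑ j, g i j = a i) ∧
      (∀ j, ∑ i, g i j = b j) ∧ ∑ i, ∑ j, g i j * c i j ≤ C := by
  let T : (I × J → ℝ) →ₗ[ℝ] ((I → ℝ) × (J → ℝ) × ℝ) :=
    { toFun := fun g => (fun i => ∑ j, g (i, j), fun j => ∑ i, g (i, j),
        ∑ i, ∑ j, g (i, j) * c i j)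
      map_add' := by
        intro x y
        ext <;> simp [Finset.sum_add_distrib, add_mul]
      map_smul' := by
        intro r x
        ext <;> simp [Finset.mul_sum, mul_assoc] }
  let S := T '' stdSimplex ℝ (I × J)
  let B : Set ((I → ℝ) × (J → ℝ) × ℝ) := {p | p.1 = a ∧ p.2.1 = b ∧ p.2.2 ≤ C}
  by_cases hdis : Disjoint S B
  · exfalso
    have hScv : Convex ℝ S := (convex_stdSimplex ℝ _).linear_image T
    have hScp : IsCompact S := (isCompact_stdSimplex ℝ _).image T.continuous_of_finiteDimensional
    have hBcv : Convex ℝ B := by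
      rintro ⟨x1, x2, x3⟩ ⟨h1, h2, h3⟩ ⟨y1, y2, y3⟩ ⟨k1, k2, k3⟩ s t hs ht hst
      dsimp at *
      subst h1 h2
      refine ⟨?_, ?_, ?_⟩
      · dsimp; rw [k1, ← add_smul, hst, one_smul]
      · dsimp; rw [k2, ← add_smul, hst, one_smul]
      · dsimp
        calc s * x3 + t * y3 ≤ s * C + t * C := by gcongr
          _ = C := by rw [← add_mul, hst, one_mul]
    have hBcl : IsClosed B := by
      have e : B = {p | p.1 = a} ∩ ({p | p.2.1 = b} ∩ {p | p.2.2 ≤ C}) := rfl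
      rw [e]
      exact (isClosed_eq (by fun_prop) (by fun_prop)).inter
        ((isClosed_eq (by fun_prop) (by fun_prop)).inter (isClosed_le (by fun_prop) (by fun_prop)))
    obtain ⟨F, u, v, hu, huv, hv⟩ := geometric_hahn_banach_compact_closed hScv hScp hBcv hBcl hdis
    set φ : I → ℝ := fun i => F (Pi.single i 1, 0, 0) with hφ
    set ψ : J → ℝ := fun j => F (0, Pi.single j 1, 0) with hψ
    set l : ℝ := F (0, 0, 1) with hl
    have hF : ∀ f g s, F (f, g, s) = ∑ i, φ i * f i + ∑ j, ψ j * g j + l * s := by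
      intro f g s
      have e : ((f, g, s) : (I → ℝ) × (J → ℝ) × ℝ)
          = (∑ i, f i • ((Pi.single i 1, 0, 0) : (I → ℝ) × (J → ℝ) × ℝ))
          + (∑ j, g j • ((0, Pi.single j 1, 0) : (I → ℝ) × (J → ℝ) × ℝ))
          + s • ((0, 0, 1) : (I → ℝ) × (J → ℝ) × ℝ) := by
        refine Prod.ext ?_ (Prod.ext ?_ ?_)
        · ext i
          simp [Prod.fst_sum, Finset.sum_apply, Pi.single_apply]
        · ext j
          simp [Prod.fst_sum, Prod.snd_sum, Finset.sum_apply, Pi.single_apply]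
        · simp [Prod.snd_sum]
      rw [e]
      simp only [map_add, map_sum, map_smul, smul_eq_mul]
      simp only [hφ, hψ, hl, mul_comm]
    have h1 : ∀ i j, φ i + ψ j + l * c i j < u := by
      intro i j
      have := hu (T (Pi.single (i, j) 1)) ⟨_, single_mem_stdSimplex ℝ (i, j), rfl⟩
      have e : T (Pi.single (i, j) 1) = (Pi.single i 1, Pi.single j 1, c i j) := by
        refine Prod.ext ?_ (Prod.ext ?_ ?_)
        · ext i'
          simp only [T, LinearMap.coe_mk, AddHom.coe_mk, Pi.single_apply, Prod.mk.injEq]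
          by_cases h : i' = i <;> simp [h]
        · ext i'
          simp only [T, LinearMap.coe_mk, AddHom.coe_mk, Pi.single_apply, Prod.mk.injEq]
          by_cases h : i' = j <;> simp [h]
        · simp only [T, LinearMap.coe_mk, AddHom.coe_mk, Pi.single_apply, Prod.mk.injEq]
          rw [Finset.sum_eq_single i, Finset.sum_eq_single j] <;> simp +contextual
      rw [e, hF] at this
      simpa [Pi.single_apply] using this
    set A := ∑ i, φ i * a i with hA
    set D := ∑ j, ψ j * b j with hD
    have h2 : ∀ s ≤ C, v < A + D + l * s := by
      intro s hs
      have := hv (a, b, s) ⟨rfl, rfl, hs⟩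
      rwa [hF] at this
    have hl0 : l ≤ 0 := by
      by_contra! hpos
      have := h2 (min C ((v - A - D) / l)) (min_le_left _ _)
      have h3 : l * min C ((v - A - D) / l) ≤ l * ((v - A - D) / l) := by
        gcongr; exact min_le_right _ _
      rw [mul_div_cancel₀ _ hpos.ne'] at h3
      linarith
    rcases hl0.lt_or_eq with hneg | hz
    · have hk : 0 < -l := by linarith
      have := H (fun i => (φ i - u) / (-l)) (fun j => - ψ j / (-l)) (by
        intro i j
        rw [← sub_div, div_le_iff₀ hk]
        have := h1 i j
        linarith)
      have e1 : ∑ i, (φ i - u) / (-l) * a i = (A - u) / (-l) := by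
        simp only [hA, div_mul_eq_mul_div, ← Finset.sum_div, sub_mul, Finset.sum_sub_distrib]
        rw [← Finset.mul_sum, ha1, mul_one]
      have e2 : ∑ j, - ψ j / (-l) * b j = -D / (-l) := by
        simp only [hD, div_mul_eq_mul_div, ← Finset.sum_div, neg_mul, Finset.sum_neg_distrib]
      rw [e1, e2, ← sub_div, div_le_iff₀ hk] at this
      have := h2 C le_rfl
      linarith
    · have h3 := h2 C le_rfl
      rw [hz] at h3
      have e : A + D = ∑ i, ∑ j, (φ i + ψ j) * (a i * b j) := by
        have e1 : ∀ i, ∑ j, (φ i + ψ j) * (a i * b j) = φ i * a i + a i * D := by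
          intro i
          simp only [add_mul, Finset.sum_add_distrib]
          rw [← Finset.mul_sum, ← Finset.mul_sum, hb1, mul_one, hD, Finset.mul_sum]
          congr 1
          exact Finset.sum_congr rfl fun j _ => by ring
        simp only [e1, Finset.sum_add_distrib, ← Finset.sum_mul, ha1, one_mul, hA]
      have h4 : A + D ≤ ∑ i, ∑ j, u * (a i * b j) := by
        rw [e]
        refine Finset.sum_le_sum fun i _ => Finset.sum_le_sum fun j _ => ?_
        apply mul_le_mul_of_nonneg_right _ (mul_nonneg (ha i) (hb j))
        have := h1 i j
        rw [hz] at this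
        linarith
      have h5 : ∑ i, ∑ j, u * (a i * b j) = u := by
        simp only [← Finset.mul_sum, hb1, mul_one, ha1]
      linarith
  · rw [Set.not_disjoint_iff] at hdis
    obtain ⟨_, ⟨g, hg, rfl⟩, h1, h2, h3⟩ := hdis
    exact ⟨fun i j => g (i, j), fun i j => hg.1 _, fun i => congrFun h1 i,
      fun j => congrFun h2 j, h3⟩

variable {d : ℕ}

/-- finite first moment probability measure -/
def Good (μ : Measure (EV d)) : Prop :=
  IsProbabilityMeasure μ ∧ Integrable (fun x => ‖x‖) μ

theorem Good.lip {μ : Measure (EV d)} (hμ : Good μ) {f : EV d → ℝ} {K : NNReal}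
    (hf : LipschitzWith K f) : Integrable f μ := by
  have := hμ.1
  refine Integrable.mono' (g := fun x => |f 0| + K * ‖x‖)
    ((integrable_const _).add (hμ.2.const_mul _)) hf.continuous.aestronglyMeasurable ?_
  filter_upwards with x
  have h := hf.dist_le_mul x 0
  rw [dist_eq_norm, dist_zero_right] at h
  have := norm_sub_norm_le (f x) (f 0)
  simp only [Real.norm_eq_abs] at *
  linarith

theorem simple_integral (μ : Measure (EV d)) [IsProbabilityMeasure μ] (q : SimpleFunc (EV d) (EV d))
    (F : EV d → ℝ) : ∫ x, F (q x) ∂μ = ∑ i : q.range, F i * μ.real (q ⁻¹' {(i : EV d)}) := by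
  have e : ∀ x, F (q x) = ∑ i : q.range, (q ⁻¹' {(i : EV d)}).indicator (fun _ => F i) x := by
    intro x
    rw [Finset.sum_eq_single ⟨q x, q.mem_range_self x⟩]
    · simp
    · intro b _ hb
      simp only [Set.indicator_apply_eq_zero, Set.mem_preimage, Set.mem_singleton_iff]
      intro h
      exact absurd (Subtype.ext h.symm) hb
    · simp
  simp only [e]
  rw [integral_finsetSum]
  · refine Finset.sum_congr rfl fun i _ => ?_
    rw [integral_indicator_const _ (q.measurableSet_preimage _), smul_eq_mul, mul_comm]
  · intro i _
    exact (integrable_const _).indicator (q.measurableSet_preimage _)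

theorem simple_split (μ : Measure (EV d)) (q : SimpleFunc (EV d) (EV d)) (s : Set (EV d))
    (hs : MeasurableSet s) : ∑ i : q.range, μ (s ∩ q ⁻¹' {(i : EV d)}) = μ s := by
  rw [← measure_biUnion_finset (s := Finset.univ)]
  · congr 1
    ext x
    simp only [Set.mem_iUnion, Set.mem_inter_iff, Set.mem_preimage, Set.mem_singleton_iff]
    constructor
    · rintro ⟨i, _, h, _⟩; exact h
    · intro h; exact ⟨⟨q x, q.mem_range_self x⟩, Finset.mem_univ _, h, rfl⟩
  · intro i _ j _ hij
    simp only [Function.onFun]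
    rw [Set.disjoint_left]
    rintro x ⟨_, hx⟩ ⟨_, hy⟩
    simp only [Set.mem_preimage, Set.mem_singleton_iff] at hx hy
    exact hij (Subtype.ext (hx.symm.trans hy))
  · intro i _
    exact hs.inter (q.measurableSet_preimage _)

theorem glue (μ ν : Measure (EV d)) [IsProbabilityMeasure μ] [IsProbabilityMeasure ν]
    (q r : SimpleFunc (EV d) (EV d)) (g : q.range → r.range → ℝ) (hg : ∀ i j, 0 ≤ g i j)
    (h1 : ∀ i, ∑ j, g i j = μ.real (q ⁻¹' {(i : EV d)}))
    (h2 : ∀ j, ∑ i, g i j = ν.real (r ⁻¹' {(j : EV d)})) :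
    ∃ γ : Measure (EV d × EV d), IsCoupling γ μ ν ∧
      ∫⁻ x, ‖q x.1 - r x.2‖ₑ ∂γ ≤ ENNReal.ofReal (∑ i, ∑ j, g i j * ‖(i : EV d) - j‖) := by
  let A : q.range → Set (EV d) := fun i => q ⁻¹' {(i : EV d)}
  let B : r.range → Set (EV d) := fun i => r ⁻¹' {(i : EV d)}
  have hAm : ∀ i, MeasurableSet (A i) := fun i => q.measurableSet_preimage _
  have hBm : ∀ i, MeasurableSet (B i) := fun i => r.measurableSet_preimage _
  let m : q.range → Measure (EV d) := fun i => (μ (A i))⁻¹ • μ.restrict (A i)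
  let n : r.range → Measure (EV d) := fun i => (ν (B i))⁻¹ • ν.restrict (B i)
  have hg0 : ∀ i j, μ (A i) = 0 → g i j = 0 := by
    intro i j h
    have e := h1 i
    rw [show μ.real (q ⁻¹' {(i : EV d)}) = 0 by simp only [Measure.real]; rw [show q ⁻¹' {(i : EV d)} = A i from rfl, h]; rfl] at e
    exact (Finset.sum_eq_zero_iff_of_nonneg (fun j _ => hg i j)).1 e j (Finset.mem_univ _)
  have hg0' : ∀ i j, ν (B j) = 0 → g i j = 0 := by
    intro i j h
    have e := h2 j
    rw [show ν.real (r ⁻¹' {(j : EV d)}) = 0 by simp only [Measure.real]; rw [show r ⁻¹' {(j : EV d)} = B j from rfl, h]; rfl] at e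
    exact (Finset.sum_eq_zero_iff_of_nonneg (fun i _ => hg i j)).1 e i (Finset.mem_univ _)
  have hm1 : ∀ i, μ (A i) ≠ 0 → m i Set.univ = 1 := by
    intro i h
    simp only [m, Measure.smul_apply, smul_eq_mul, Measure.restrict_apply_univ]
    exact ENNReal.inv_mul_cancel h (measure_ne_top _ _)
  have hn1 : ∀ i, ν (B i) ≠ 0 → n i Set.univ = 1 := by
    intro i h
    simp only [n, Measure.smul_apply, smul_eq_mul, Measure.restrict_apply_univ]
    exact ENNReal.inv_mul_cancel h (measure_ne_top _ _)
  have gm : ∀ i j, ENNReal.ofReal (g i j) * m i Set.univ = ENNReal.ofReal (g i j) := by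
    intro i j
    by_cases h : μ (A i) = 0
    · simp [hg0 i j h]
    · rw [hm1 i h, mul_one]
  have gn : ∀ i j, ENNReal.ofReal (g i j) * n j Set.univ = ENNReal.ofReal (g i j) := by
    intro i j
    by_cases h : ν (B j) = 0
    · simp [hg0' i j h]
    · rw [hn1 j h, mul_one]
  have sfm : ∀ i, SFinite (m i) := fun i => by dsimp [m]; infer_instance
  have sfn : ∀ i, SFinite (n i) := fun i => by dsimp [n]; infer_instance
  let γ : Measure (EV d × EV d) := ∑ i, ∑ j, ENNReal.ofReal (g i j) • (m i).prod (n j)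
  refine ⟨γ, ⟨?_, ?_⟩, ?_⟩
  · ext s hs
    rw [Measure.map_apply measurable_fst hs]
    simp only [γ, Measure.finsetSum_apply, Measure.smul_apply, smul_eq_mul]
    have e : ∀ i j, ENNReal.ofReal (g i j) * (m i).prod (n j) (Prod.fst ⁻¹' s)
        = ENNReal.ofReal (g i j) * m i s := by
      intro i j
      rw [← Set.prod_univ, Measure.prod_prod, mul_left_comm, gn, mul_comm]
    simp only [e, ← Finset.sum_mul]
    rw [← simple_split μ q s hs]
    refine Finset.sum_congr rfl fun i _ => ?_
    rw [← ENNReal.ofReal_sum_of_nonneg (fun j _ => hg i j), h1 i, Measure.real,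
      ENNReal.ofReal_toReal (measure_ne_top _ _)]
    simp only [m, Measure.smul_apply, smul_eq_mul, Measure.restrict_apply hs]
    by_cases h : μ (A i) = 0
    · rw [show μ (q ⁻¹' {(i:EV d)}) = 0 from h, zero_mul]
      exact (measure_mono_null Set.inter_subset_right h).symm
    · rw [← mul_assoc, show q ⁻¹' {(i:EV d)} = A i from rfl, ENNReal.mul_inv_cancel h (measure_ne_top _ _), one_mul]
  · ext s hs
    rw [Measure.map_apply measurable_snd hs]
    simp only [γ, Measure.finsetSum_apply, Measure.smul_apply, smul_eq_mul]
    have e : ∀ i j, ENNReal.ofReal (g i j) * (m i).prod (n j) (Prod.snd ⁻¹' s)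
        = ENNReal.ofReal (g i j) * n j s := by
      intro i j
      rw [← Set.univ_prod, Measure.prod_prod, ← mul_assoc, gm]
    simp only [e]
    rw [Finset.sum_comm]
    simp only [← Finset.sum_mul]
    rw [← simple_split ν r s hs]
    refine Finset.sum_congr rfl fun i _ => ?_
    rw [← ENNReal.ofReal_sum_of_nonneg (fun j _ => hg j i), h2 i, Measure.real,
      ENNReal.ofReal_toReal (measure_ne_top _ _)]
    simp only [n, Measure.smul_apply, smul_eq_mul, Measure.restrict_apply hs]
    by_cases h : ν (B i) = 0
    · rw [show ν (r ⁻¹' {(i:EV d)}) = 0 from h, zero_mul]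
      exact (measure_mono_null Set.inter_subset_right h).symm
    · rw [← mul_assoc, show r ⁻¹' {(i:EV d)} = B i from rfl, ENNReal.mul_inv_cancel h (measure_ne_top _ _), one_mul]
  · simp only [γ, lintegral_finsetSum_measure, lintegral_smul_measure, smul_eq_mul]
    rw [ENNReal.ofReal_sum_of_nonneg
      (fun i _ => Finset.sum_nonneg fun j _ => mul_nonneg (hg i j) (norm_nonneg _))]
    refine Finset.sum_le_sum fun i _ => ?_
    rw [ENNReal.ofReal_sum_of_nonneg (fun j _ => mul_nonneg (hg i j) (norm_nonneg _))]
    refine Finset.sum_le_sum fun j _ => ?_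
    have hae1 : ∀ᵐ x ∂(m i), q x = i := by
      apply Measure.ae_smul_measure
      filter_upwards [ae_restrict_mem (hAm i)] with x hx using hx
    have hae2 : ∀ᵐ x ∂(n j), r x = j := by
      apply Measure.ae_smul_measure
      filter_upwards [ae_restrict_mem (hBm j)] with x hx using hx
    have hae : ∀ᵐ x ∂((m i).prod (n j)), ‖q x.1 - r x.2‖ₑ = ‖(i : EV d) - j‖ₑ := by
      have k1 : ∀ᵐ x ∂((m i).prod (n j)), q x.1 = i :=
        Measure.quasiMeasurePreserving_fst.ae hae1
      have k2 : ∀ᵐ x ∂((m i).prod (n j)), r x.2 = j :=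
        Measure.quasiMeasurePreserving_snd.ae hae2
      filter_upwards [k1, k2] with x hx hy
      rw [hx, hy]
    rw [lintegral_congr_ae hae, lintegral_const, ← Set.univ_prod_univ, Measure.prod_prod,
      ENNReal.ofReal_mul (hg i j), ofReal_norm]
    calc _ = (ENNReal.ofReal (g i j) * m i Set.univ) * n j Set.univ * ‖(i:EV d) - j‖ₑ := by ring
      _ ≤ _ := by rw [gm, gn]

theorem kr (μ ν : Measure (EV d)) (hμ : Good μ) (hν : Good ν) (c : ℝ)
    (h : ∀ f : EV d → ℝ, LipschitzWith 1 f → ∫ x, f x ∂μ - ∫ x, f x ∂ν ≤ c) (δ : ℝ) (hδ : 0 < δ) :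
    ∃ γ : Measure (EV d × EV d), IsCoupling γ μ ν ∧ ∫ x, ‖x.1 - x.2‖ ∂γ ≤ c + δ := by
  classical
  have := hμ.1
  have := hν.1
  have approx : ∀ μ : Measure (EV d), Good μ → ∃ q : SimpleFunc (EV d) (EV d),
      ∫⁻ x, ‖x - q x‖ₑ ∂μ ≤ ENNReal.ofReal (δ / 4) := by
    intro μ hμ
    have hm : MemLp (fun x : EV d => x) 1 μ := by
      rw [memLp_one_iff_integrable]
      exact (integrable_norm_iff (by fun_prop)).1 hμ.2
    obtain ⟨q, hq, -⟩ := hm.exists_simpleFunc_eLpNorm_sub_lt (by simp)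
      (ε := ENNReal.ofReal (δ/4)) (by simp; linarith)
    refine ⟨q, ?_⟩
    rw [eLpNorm_one_eq_lintegral_enorm] at hq
    exact hq.le
  have approx' : ∀ (μ : Measure (EV d)) (q : SimpleFunc (EV d) (EV d)) (F : EV d → ℝ), Good μ →
      ∫⁻ x, ‖x - q x‖ₑ ∂μ ≤ ENNReal.ofReal (δ / 4) → LipschitzWith 1 F →
      |∫ x, F x ∂μ - ∫ x, F (q x) ∂μ| ≤ δ / 4 := by
    intro μ q F hμ hq hF
    have := hμ.1
    have hi : Integrable (fun x => F (q x)) μ :=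
      ((q.map F).integrable_of_isFiniteMeasure)
    rw [← integral_sub (hμ.lip hF) hi, ← Real.norm_eq_abs]
    have h1 : ‖∫ x, (F x - F (q x)) ∂μ‖ₑ ≤ ENNReal.ofReal (δ/4) := by
      refine (enorm_integral_le_lintegral_enorm _).trans (le_trans (lintegral_mono fun x => ?_) hq)
      have := hF.edist_le_mul x (q x)
      simpa [edist_eq_enorm_sub] using this
    rw [← ofReal_norm] at h1
    exact (ENNReal.ofReal_le_ofReal_iff (by linarith)).1 h1
  obtain ⟨q, hq⟩ := approx μ hμ
  obtain ⟨r, hr⟩ := approx ν hν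
  have hsum : ∀ (μ : Measure (EV d)) [IsProbabilityMeasure μ] (q : SimpleFunc (EV d) (EV d)),
      ∑ i : q.range, μ.real (q ⁻¹' {(i : EV d)}) = 1 := by
    intro μ _ q
    have := simple_integral μ q (fun _ => 1)
    simpa using this.symm
  have hne : Nonempty r.range := ⟨⟨r 0, r.mem_range_self 0⟩⟩
  obtain ⟨g, hg0, hg1, hg2, hgc⟩ := finite_duality
    (fun i : q.range => μ.real (q ⁻¹' {(i : EV d)})) (fun i : r.range => ν.real (r ⁻¹' {(i : EV d)}))
    (fun _ => measureReal_nonneg) (fun _ => measureReal_nonneg) (hsum μ q) (hsum ν r)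
    (fun i j => ‖(i : EV d) - j‖) (c + δ / 2) (by
      intro φ ψ hφ
      let F : EV d → ℝ := fun x => Finset.univ.inf' Finset.univ_nonempty
        fun j : r.range => ‖x - j‖ + ψ j
      have hF : LipschitzWith 1 F := by
        apply LipschitzWith.of_le_add
        intro x y
        obtain ⟨j, -, hj⟩ := Finset.exists_mem_eq_inf' (Finset.univ_nonempty (α := r.range))
          (fun j : r.range => ‖y - j‖ + ψ j)
        have h1 : F x ≤ ‖x - j‖ + ψ j := Finset.inf'_le _ (Finset.mem_univ j)
        have h2 : F y = ‖y - j‖ + ψ j := hj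
        have h3 : ‖x - j‖ ≤ ‖x - y‖ + ‖y - j‖ := norm_sub_le_norm_sub_add_norm_sub _ _ _
        rw [dist_eq_norm]
        linarith
      have h1 : ∑ i, φ i * μ.real (q ⁻¹' {(i : EV d)}) ≤ ∫ x, F (q x) ∂μ := by
        rw [simple_integral]
        refine Finset.sum_le_sum fun i _ => mul_le_mul_of_nonneg_right ?_ measureReal_nonneg
        apply Finset.le_inf'
        intro j _
        have := hφ i j
        linarith
      have h2 : ∫ x, F (r x) ∂ν ≤ ∑ i, ψ i * ν.real (r ⁻¹' {(i : EV d)}) := by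
        rw [simple_integral]
        refine Finset.sum_le_sum fun i _ => mul_le_mul_of_nonneg_right ?_ measureReal_nonneg
        refine (Finset.inf'_le _ (Finset.mem_univ i)).trans ?_
        simp
      have h3 := abs_le.1 (approx' μ q F hμ hq hF)
      have h4 := abs_le.1 (approx' ν r F hν hr hF)
      have h5 := h F hF
      linarith [h3.1, h3.2, h4.1, h4.2])
  obtain ⟨γ, hγ, hc⟩ := glue μ ν q r g hg0 hg1 hg2
  refine ⟨γ, hγ, ?_⟩
  have hcd : 0 ≤ c := by
    have := h (fun _ => 0) (LipschitzWith.of_le_add (by intro x y; simp))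
    simpa using this
  have e1 : ∫⁻ x, ‖x.1 - q x.1‖ₑ ∂γ ≤ ENNReal.ofReal (δ/4) := by
    rw [← hγ.1, lintegral_map (by fun_prop) measurable_fst] at hq
    exact hq
  have e2 : ∫⁻ x, ‖x.2 - r x.2‖ₑ ∂γ ≤ ENNReal.ofReal (δ/4) := by
    rw [← hγ.2, lintegral_map (by fun_prop) measurable_snd] at hr
    exact hr
  have e3 : ∫⁻ x, ‖x.1 - x.2‖ₑ ∂γ ≤ ENNReal.ofReal (c + δ) := by
    calc ∫⁻ x, ‖x.1 - x.2‖ₑ ∂γ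
        ≤ ∫⁻ x, (‖x.1 - q x.1‖ₑ + ‖q x.1 - r x.2‖ₑ) + ‖x.2 - r x.2‖ₑ ∂γ := by
          refine lintegral_mono fun x => ?_
          have : x.1 - x.2 = (x.1 - q x.1) + (q x.1 - r x.2) - (x.2 - r x.2) := by abel
          calc ‖x.1 - x.2‖ₑ = ‖(x.1 - q x.1) + (q x.1 - r x.2) - (x.2 - r x.2)‖ₑ := by rw [← this]
            _ ≤ _ := (enorm_sub_le).trans (by gcongr; exact enorm_add_le _ _)
      _ = (∫⁻ x, ‖x.1 - q x.1‖ₑ ∂γ + ∫⁻ x, ‖q x.1 - r x.2‖ₑ ∂γ) + ∫⁻ x, ‖x.2 - r x.2‖ₑ ∂γ := by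
          rw [lintegral_add_left (by fun_prop), lintegral_add_left (by fun_prop)]
      _ ≤ (ENNReal.ofReal (δ/4) + ENNReal.ofReal (c + δ/2)) + ENNReal.ofReal (δ/4) := by
          gcongr
          exact hc.trans (ENNReal.ofReal_le_ofReal hgc)
      _ = ENNReal.ofReal (c + δ) := by
          rw [← ENNReal.ofReal_add (by linarith) (by linarith),
            ← ENNReal.ofReal_add (by linarith) (by linarith)]
          congr 1; ring
  rw [integral_norm_eq_lintegral_enorm (by fun_prop)]
  exact ENNReal.toReal_le_of_le_ofReal (by linarith) e3

end PartB

section PartCC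
open MeasureTheory
open scoped ENNReal RealInnerProductSpace
variable {d : ℕ}

/-- continuous function of at most exponential growth -/
structure EG (g : EV d → ℝ) : Prop where
  cont : Continuous g
  bd : ∃ A B : ℝ, 0 ≤ A ∧ 0 ≤ B ∧ ∀ z, |g z| ≤ A * Real.exp (B * ‖z‖)

theorem EG.mul {f g : EV d → ℝ} (hf : EG f) (hg : EG g) : EG (fun z => f z * g z) := by
  obtain ⟨A, B, hA, hB, h⟩ := hf.bd
  obtain ⟨A', B', hA', hB', h'⟩ := hg.bd
  refine ⟨hf.cont.mul hg.cont, A * A', B + B', by positivity, by positivity, fun z => ?_⟩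
  rw [abs_mul, add_mul, Real.exp_add]
  calc |f z| * |g z| ≤ (A * Real.exp (B * ‖z‖)) * (A' * Real.exp (B' * ‖z‖)) := by
        gcongr
        · exact h z
        · exact h' z
    _ = _ := by ring

theorem EG.add {f g : EV d → ℝ} (hf : EG f) (hg : EG g) : EG (fun z => f z + g z) := by
  obtain ⟨A, B, hA, hB, h⟩ := hf.bd
  obtain ⟨A', B', hA', hB', h'⟩ := hg.bd
  refine ⟨hf.cont.add hg.cont, A + A', B + B', by positivity, by positivity, fun z => ?_⟩
  calc |f z + g z| ≤ |f z| + |g z| := abs_add_le _ _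
    _ ≤ A * Real.exp (B * ‖z‖) + A' * Real.exp (B' * ‖z‖) := add_le_add (h z) (h' z)
    _ ≤ A * Real.exp ((B + B') * ‖z‖) + A' * Real.exp ((B + B') * ‖z‖) := by
        gcongr <;> linarith
    _ = _ := by ring

theorem EG.const (c : ℝ) : EG (fun _ : EV d => c) :=
  ⟨continuous_const, |c|, 0, by positivity, le_rfl, fun z => by simp⟩

theorem EG.norm : EG (fun z : EV d => ‖z‖) := by
  refine ⟨continuous_norm, 1, 1, by simp, by simp, fun z => ?_⟩
  rw [abs_of_nonneg (norm_nonneg z)]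
  have := Real.add_one_le_exp ‖z‖
  simp only [one_mul]
  linarith

theorem EG.of_le {f g : EV d → ℝ} (hg : EG g) (hf : Continuous f) (h : ∀ z, |f z| ≤ g z) :
    EG f := by
  obtain ⟨A', B', hA', hB', h'⟩ := hg.bd
  exact ⟨hf, A', B', hA', hB', fun z => (h z).trans ((le_abs_self _).trans (h' z))⟩

theorem EG.lip {f : EV d → ℝ} {K : NNReal} (hf : LipschitzWith K f) : EG f := by
  refine ((EG.const |f 0|).add ((EG.const (K:ℝ)).mul EG.norm)).of_le hf.continuous fun x => ?_
  have h := hf.dist_le_mul x 0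
  rw [dist_eq_norm, dist_zero_right] at h
  have := norm_sub_norm_le (f x) (f 0)
  simp only [Real.norm_eq_abs] at *
  linarith

theorem EG.inner (w : EV d) : EG (fun z => ⟪z, w⟫) := by
  refine ((EG.const ‖w‖).mul EG.norm).of_le (by fun_prop) fun x => ?_
  rw [mul_comm]
  exact abs_real_inner_le_norm _ _

theorem EG.exp_lip {f : EV d → ℝ} {K : NNReal} (hf : LipschitzWith K f) (s : ℝ) :
    EG (fun z => Real.exp (s * f z)) := by
  refine ⟨by have := hf.continuous; fun_prop, Real.exp (|s| * |f 0|), |s| * K, by positivity, by positivity, fun x => ?_⟩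
  rw [abs_of_pos (Real.exp_pos _), ← Real.exp_add]
  apply Real.exp_le_exp.2
  have h := hf.dist_le_mul x 0
  rw [dist_eq_norm, dist_zero_right] at h
  have := norm_sub_norm_le (f x) (f 0)
  simp only [Real.norm_eq_abs] at *
  calc s * f x ≤ |s| * |f x| := by rw [← abs_mul]; exact le_abs_self _
    _ ≤ |s| * (|f 0| + K * ‖x‖) := by gcongr; linarith
    _ = _ := by ring

/-- potentials growing at least quadratically -/
structure Pot (V : EV d → ℝ) : Prop where
  cont : Continuous V
  bd : ∃ c C : ℝ, 0 < c ∧ ∀ z, c * ‖z‖ ^ 2 - C ≤ V z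

theorem gauss_int (c : ℝ) (hc : 0 < c) : Integrable (fun z : EV d => Real.exp (-c * ‖z‖ ^ 2)) := by
  have := (GaussianFourier.integrable_cexp_neg_mul_sq_norm_add (V := EV d) (b := (c:ℂ)) (by simpa) 0 0).norm
  refine this.congr ?_
  filter_upwards with z
  rw [Complex.norm_exp]
  congr 1
  simp [← Complex.ofReal_pow]

theorem Pot.int {V : EV d → ℝ} (hV : Pot V) {g : EV d → ℝ} (hg : EG g) :
    Integrable (fun z => g z * Real.exp (-V z)) := by
  obtain ⟨c, C, hc, hb⟩ := hV.bd
  obtain ⟨A, B, hA, hB, h⟩ := hg.bd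
  refine Integrable.mono' (g := fun z => (A * Real.exp (B ^ 2 / (2 * c) + C)) * Real.exp (-(c/2) * ‖z‖ ^ 2))
    ((gauss_int (c/2) (by positivity)).const_mul _)
    (by have := hg.cont; have := hV.cont; exact (by fun_prop : Continuous _).aestronglyMeasurable) ?_
  filter_upwards with z
  rw [norm_mul, Real.norm_eq_abs, Real.norm_eq_abs, abs_of_pos (Real.exp_pos _)]
  calc |g z| * Real.exp (-V z) ≤ (A * Real.exp (B * ‖z‖)) * Real.exp (C - c * ‖z‖ ^ 2) := by
        gcongr
        · exact h z
        · linarith [hb z]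
    _ = A * Real.exp (B * ‖z‖ + (C - c * ‖z‖ ^ 2)) := by rw [Real.exp_add]; ring
    _ ≤ A * Real.exp ((B ^ 2 / (2 * c) + C) + (-(c/2) * ‖z‖ ^ 2)) := by
        apply mul_le_mul_of_nonneg_left (Real.exp_le_exp.2 ?_) hA
        have : 0 ≤ (B - c * ‖z‖) ^ 2 / (2 * c) := by positivity
        have e : (B - c * ‖z‖) ^ 2 / (2 * c) = B ^ 2 / (2 * c) - B * ‖z‖ + c / 2 * ‖z‖ ^ 2 := by
          field_simp
          ring
        linarith
    _ = _ := by rw [Real.exp_add]; ring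

theorem Pot.int1 {V : EV d → ℝ} (hV : Pot V) : Integrable (fun z => Real.exp (-V z)) := by
  simpa using hV.int (EG.const 1)

theorem Pot.Z_pos {V : EV d → ℝ} (hV : Pot V) : 0 < ∫ z, Real.exp (-V z) := by
  rw [integral_pos_iff_support_of_nonneg (fun z => (Real.exp_pos _).le) hV.int1]
  have : Function.support (fun z => Real.exp (-V z)) = Set.univ := by
    ext z; simp
  rw [this]
  exact isOpen_univ.measure_pos volume Set.univ_nonempty

/-- Gibbs measure -/
def gib (V : EV d → ℝ) : Measure (EV d) := densMeasure fun z => Real.exp (-V z)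

theorem Pot.lint {V : EV d → ℝ} (hV : Pot V) :
    ∫⁻ z, ENNReal.ofReal (Real.exp (-V z)) = ENNReal.ofReal (∫ z, Real.exp (-V z)) := by
  rw [ofReal_integral_eq_lintegral_ofReal hV.int1]
  filter_upwards with z using (Real.exp_pos _).le

theorem Pot.integral_gib {V : EV d → ℝ} (hV : Pot V) (g : EV d → ℝ) :
    ∫ z, g z ∂(gib V) = (∫ z, g z * Real.exp (-V z)) / ∫ z, Real.exp (-V z) := by
  have hc := hV.cont
  rw [gib, densMeasure, integral_smul_measure, integral_withDensity_eq_integral_toReal_smul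
    (by fun_prop) (by simp), hV.lint, ENNReal.toReal_inv, ENNReal.toReal_ofReal hV.Z_pos.le]
  simp only [ENNReal.toReal_ofReal (Real.exp_pos _).le, smul_eq_mul]
  rw [div_eq_inv_mul]
  congr 2
  ext z
  ring

theorem Pot.integrable_gib {V : EV d → ℝ} (hV : Pot V) {g : EV d → ℝ}
    (hg : Integrable fun z => g z * Real.exp (-V z)) : Integrable g (gib V) := by
  have hc := hV.cont
  rw [gib, densMeasure]
  apply Integrable.smul_measure
  · rw [integrable_withDensity_iff (by fun_prop) (by simp)]
    simpa only [ENNReal.toReal_ofReal (Real.exp_pos _).le]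
  · rw [hV.lint]
    simp [hV.Z_pos]

theorem Pot.eg {V : EV d → ℝ} (hV : Pot V) {g : EV d → ℝ} (hg : EG g) : Integrable g (gib V) :=
  hV.integrable_gib (hV.int hg)

theorem Pot.prob {V : EV d → ℝ} (hV : Pot V) : IsProbabilityMeasure (gib V) := by
  constructor
  rw [gib, densMeasure, Measure.smul_apply, withDensity_apply _ MeasurableSet.univ,
    Measure.restrict_univ, smul_eq_mul, hV.lint]
  exact ENNReal.inv_mul_cancel (by simp [hV.Z_pos]) (by simp)

theorem Pot.good {V : EV d → ℝ} (hV : Pot V) : Good (gib V) := ⟨hV.prob, hV.eg EG.norm⟩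

/-- midpoint strong convexity -/
def SC (α : ℝ) (V : EV d → ℝ) : Prop :=
  ∀ x y, V ((1/2:ℝ) • (x + y)) ≤ (V x + V y) / 2 - α / 8 * ‖x - y‖ ^ 2

theorem mgf_bound {V : EV d → ℝ} (hV : Pot V) {α : ℝ} (hα : 0 < α) (hs : SC α V)
    {f : EV d → ℝ} (hf : LipschitzWith 1 f) (s : ℝ) :
    (∫ z, Real.exp (s * f z) ∂(gib V)) * (∫ z, Real.exp (-s * f z) ∂(gib V))
      ≤ Real.exp (s ^ 2 / α) := by
  have hZ := hV.Z_pos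
  have hVc := hV.cont
  have hfc := hf.continuous
  have key := pl_EV d (fun z => ENNReal.ofReal (Real.exp (s * f z) * Real.exp (-V z)))
    (fun z => ENNReal.ofReal (Real.exp (-s * f z) * Real.exp (-V z)))
    (fun z => ENNReal.ofReal (Real.exp (s ^ 2 / (2 * α)) * Real.exp (-V z)))
    (by fun_prop) (by fun_prop) (by fun_prop) (by
      intro x y
      rw [← ENNReal.ofReal_pow (by positivity), ← ENNReal.ofReal_mul (by positivity)]
      apply ENNReal.ofReal_le_ofReal
      rw [← Real.exp_add, ← Real.exp_add, ← Real.exp_add, ← Real.exp_add, ← Real.exp_nat_mul]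
      apply Real.exp_le_exp.2
      have h1 := hs x y
      have h2 := hf.dist_le_mul x y
      rw [dist_eq_norm, dist_eq_norm] at h2
      simp only [NNReal.coe_one, one_mul, Real.norm_eq_abs] at h2
      have h3 : s * (f x - f y) ≤ |s| * ‖x - y‖ := by
        calc s * (f x - f y) ≤ |s * (f x - f y)| := le_abs_self _
          _ = |s| * |f x - f y| := abs_mul _ _
          _ ≤ _ := by gcongr
      have h4 : 0 ≤ (2 * |s| - α * ‖x - y‖) ^ 2 / (4 * α) := by positivity
      have h5 : (2 * |s| - α * ‖x - y‖) ^ 2 / (4 * α)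
          = s ^ 2 / α - |s| * ‖x - y‖ + α / 4 * ‖x - y‖ ^ 2 := by
        field_simp
        rw [← sq_abs s]
        ring
      have h6 : s ^ 2 / (2 * α) = (s ^ 2 / α) / 2 := by field_simp
      push_cast
      rw [h6]
      linarith)
  have conv : ∀ g : EV d → ℝ, EG g → (∀ z, 0 ≤ g z) →
      ∫⁻ z, ENNReal.ofReal (g z * Real.exp (-V z)) = ENNReal.ofReal (∫ z, g z * Real.exp (-V z)) := by
    intro g hg h0
    rw [ofReal_integral_eq_lintegral_ofReal (hV.int hg)]
    filter_upwards with z using mul_nonneg (h0 z) (Real.exp_pos _).le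
  rw [conv _ (EG.exp_lip hf s) (fun z => (Real.exp_pos _).le),
    conv _ (EG.exp_lip hf (-s)) (fun z => (Real.exp_pos _).le),
    conv _ (EG.const _) (fun z => (Real.exp_pos _).le),
    ← ENNReal.ofReal_mul (integral_nonneg fun z => by positivity),
    ← ENNReal.ofReal_pow (integral_nonneg fun z => by positivity),
    ENNReal.ofReal_le_ofReal_iff (by positivity), integral_const_mul, mul_pow, ← Real.exp_nat_mul] at key
  rw [hV.integral_gib, hV.integral_gib, div_mul_div_comm, div_le_iff₀ (by positivity)]
  refine key.trans (le_of_eq ?_)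
  rw [sq (∫ z, Real.exp (-V z))]
  congr 2
  push_cast
  field_simp

theorem cosh_lower (x : ℝ) : 1 + x ^ 2 / 2 ≤ Real.cosh x := by
  have h : ∀ y : ℝ, y ^ 2 ≤ Real.sinh y ^ 2 := by
    intro y
    apply sq_le_sq.2
    rw [Real.abs_sinh]
    exact Real.self_le_sinh_iff.2 (abs_nonneg y)
  have e : Real.cosh x = Real.cosh (x/2) ^ 2 + Real.sinh (x/2) ^ 2 := by
    rw [← Real.cosh_two_mul]; congr 1; ring
  rw [e, Real.cosh_sq]
  have := h (x/2)
  nlinarith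

theorem var_bound {V : EV d → ℝ} (hV : Pot V) {α : ℝ} (hα : 0 < α) (hs : SC α V)
    {f : EV d → ℝ} (hf : LipschitzWith 1 f) :
    ∫ z, f z * f z ∂(gib V) - (∫ z, f z ∂(gib V)) ^ 2 ≤ 1 / α := by
  set ν := gib V with hν
  have := hV.prob
  have i1 : Integrable f ν := hV.eg (EG.lip hf)
  have i2 : Integrable (fun z => f z * f z) ν := hV.eg ((EG.lip hf).mul (EG.lip hf))
  have iE : ∀ s : ℝ, Integrable (fun z => Real.exp (s * f z)) ν := fun s => hV.eg (EG.exp_lip hf s)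
  set v := ∫ z, f z * f z ∂ν - (∫ z, f z ∂ν) ^ 2 with hv
  have step : ∀ s : ℝ, 1 + s ^ 2 * v ≤ Real.exp (s ^ 2 / α) := by
    intro s
    refine le_trans ?_ (mgf_bound hV hα hs hf s)
    have p1 : Integrable (fun p : EV d × EV d => Real.exp (s * f p.1) * Real.exp (-s * f p.2)) (ν.prod ν) :=
      (iE s).mul_prod (iE (-s))
    have p2 : Integrable (fun p : EV d × EV d => Real.exp (-s * f p.1) * Real.exp (s * f p.2)) (ν.prod ν) :=
      (iE (-s)).mul_prod (iE s)
    have q1 : Integrable (fun p : EV d × EV d => (f p.1 * f p.1) * 1) (ν.prod ν) :=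
      i2.mul_prod (integrable_const 1)
    have q2 : Integrable (fun p : EV d × EV d => f p.1 * f p.2) (ν.prod ν) :=
      i1.mul_prod i1
    have q3 : Integrable (fun p : EV d × EV d => 1 * (f p.2 * f p.2)) (ν.prod ν) :=
      (integrable_const (1:ℝ)).mul_prod i2
    have q13 : Integrable (fun p : EV d × EV d => (f p.1 * f p.1) * 1 + 1 * (f p.2 * f p.2)) (ν.prod ν) := q1.add q3
    have q4 : Integrable (fun p : EV d × EV d => (f p.1 * f p.1) * 1 + 1 * (f p.2 * f p.2) - 2 * (f p.1 * f p.2)) (ν.prod ν) := q13.sub (q2.const_mul 2)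
    have e1 : ∫ p, (Real.exp (s * f p.1) * Real.exp (-s * f p.2) + Real.exp (-s * f p.1) * Real.exp (s * f p.2)) ∂(ν.prod ν)
        = 2 * ((∫ z, Real.exp (s * f z) ∂ν) * (∫ z, Real.exp (-s * f z) ∂ν)) := by
      rw [integral_add p1 p2, integral_prod_mul (fun z => Real.exp (s * f z)) (fun z => Real.exp (-s * f z)),
        integral_prod_mul (fun z => Real.exp (-s * f z)) (fun z => Real.exp (s * f z))]
      ring
    have e2 : ∫ p, (2 + s ^ 2 * ((f p.1 * f p.1) * 1 + 1 * (f p.2 * f p.2) - 2 * (f p.1 * f p.2))) ∂(ν.prod ν)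
        = 2 * (1 + s ^ 2 * v) := by
      rw [integral_add (integrable_const _) (q4.const_mul _),
        integral_const_mul, integral_sub q13 (q2.const_mul 2), integral_add q1 q3,
        integral_prod_mul (fun z => f z * f z) (fun _ => (1:ℝ)),
        integral_prod_mul (fun _ => (1:ℝ)) (fun z => f z * f z), integral_const_mul, integral_prod_mul f f]
      simp only [integral_const, probReal_univ, smul_eq_mul, hv]
      ring
    have e3 : 2 * (1 + s ^ 2 * v) ≤ 2 * ((∫ z, Real.exp (s * f z) ∂ν) * (∫ z, Real.exp (-s * f z) ∂ν)) := by
      rw [← e1, ← e2]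
      apply integral_mono ((integrable_const _).add (q4.const_mul _)) (p1.add p2)
      intro p
      dsimp
      have := cosh_lower (s * (f p.1 - f p.2))
      rw [Real.cosh_eq] at this
      rw [← Real.exp_add, ← Real.exp_add]
      have a1 : s * f p.1 + -s * f p.2 = s * (f p.1 - f p.2) := by ring
      have a2 : -s * f p.1 + s * f p.2 = -(s * (f p.1 - f p.2)) := by ring
      rw [a1, a2]
      linarith
    linarith
  by_contra! hcon
  have hcon' : 0 < v - 1/α := by linarith
  -- choose s^2 = x
  obtain ⟨x, hx0, hx1, hx2⟩ : ∃ x : ℝ, 0 < x ∧ x / α ≤ 1 ∧ x / α ^ 2 < v - 1/α := by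
    refine ⟨min α ((v - 1/α) * α ^ 2 / 2), by positivity, ?_, ?_⟩
    · rw [div_le_one hα]; exact min_le_left _ _
    · rw [div_lt_iff₀ (by positivity)]
      refine (min_le_right _ _).trans_lt ?_
      have : 0 < (v - 1/α) * α ^ 2 := by positivity
      linarith
  have h1 := step (Real.sqrt x)
  rw [Real.sq_sqrt hx0.le] at h1
  have h2 := Real.abs_exp_sub_one_sub_id_le (x := x / α) (by rw [abs_of_pos (by positivity)]; exact hx1)
  have h3 := (abs_le.1 h2).2
  have h4 : x * v ≤ x * (1 / α + x / α ^ 2) := by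
    have : x * (1 / α + x / α ^ 2) = x / α + (x / α) ^ 2 := by field_simp
    rw [this]; linarith
  have h5 := le_of_mul_le_mul_left h4 hx0
  linarith

theorem cov_bound {V : EV d → ℝ} (hV : Pot V) {α : ℝ} (hα : 0 < α) (hs : SC α V)
    {f : EV d → ℝ} (hf : LipschitzWith 1 f) (w : EV d) :
    ∫ z, f z * ⟪z, w⟫ ∂(gib V) - (∫ z, f z ∂(gib V)) * (∫ z, ⟪z, w⟫ ∂(gib V)) ≤ ‖w‖ / α := by
  by_cases hw : w = 0
  · simp [hw]
  have hw0 : 0 < ‖w‖ := norm_pos_iff.2 hw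
  set ν := gib V with hν
  have := hV.prob
  set l : EV d → ℝ := fun z => ‖w‖⁻¹ * ⟪z, w⟫ with hl
  have hll : LipschitzWith 1 l := by
    apply LipschitzWith.of_dist_le_mul
    intro x y
    rw [Real.dist_eq, hl]
    dsimp
    rw [← mul_sub, ← inner_sub_left, abs_mul, abs_of_pos (by positivity), one_mul, dist_eq_norm,
      inv_mul_le_iff₀ hw0, mul_comm]
    exact abs_real_inner_le_norm _ _
  set g : EV d → ℝ := fun z => (1/2:ℝ) * (f z + l z) with hg
  have hgl : LipschitzWith 1 g := by
    apply LipschitzWith.of_dist_le_mul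
    intro x y
    have h1 := hf.dist_le_mul x y
    have h2 := hll.dist_le_mul x y
    rw [Real.dist_eq] at *
    simp only [NNReal.coe_one, one_mul, hg] at *
    rw [abs_le] at *
    constructor <;> linarith [h1.1, h1.2, h2.1, h2.2]
  have i1 : Integrable f ν := hV.eg (EG.lip hf)
  have i2 : Integrable l ν := hV.eg (EG.lip hll)
  have i11 : Integrable (fun z => f z * f z) ν := hV.eg ((EG.lip hf).mul (EG.lip hf))
  have i12 : Integrable (fun z => f z * l z) ν := hV.eg ((EG.lip hf).mul (EG.lip hll))
  have i22 : Integrable (fun z => l z * l z) ν := hV.eg ((EG.lip hll).mul (EG.lip hll))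
  have hb := var_bound hV hα hs hgl
  set a := ∫ z, f z ∂ν
  set b := ∫ z, l z ∂ν
  set A := ∫ z, f z * f z ∂ν
  set B := ∫ z, f z * l z ∂ν
  set D := ∫ z, l z * l z ∂ν
  have e1 : ∫ z, g z ∂ν = (1/2) * (a + b) := by
    rw [hg, integral_const_mul, integral_add i1 i2]
  have e2 : ∫ z, g z * g z ∂ν = (1/4) * (A + 2 * B + D) := by
    have : ∀ z, g z * g z = (1/4) * (f z * f z + 2 * (f z * l z) + l z * l z) := by
      intro z; rw [hg]; ring
    simp only [this]
    have j : Integrable (fun z => f z * f z + 2 * (f z * l z)) ν := i11.add (i12.const_mul 2)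
    rw [integral_const_mul, integral_add j i22,
      integral_add i11 (i12.const_mul 2), integral_const_mul]
  rw [e1, e2] at hb
  have e3 : 0 ≤ A - 2 * B + D - (a - b) ^ 2 := by
    have h0 : 0 ≤ ∫ z, (f z * f z - 2 * (f z * l z) + l z * l z - 2 * (a - b) * (f z - l z) + (a - b) ^ 2) ∂ν := by
      apply integral_nonneg
      intro z
      have : 0 ≤ (f z - l z - (a - b)) ^ 2 := sq_nonneg _
      dsimp
      linarith
    have j1 : Integrable (fun z => f z * f z - 2 * (f z * l z)) ν := i11.sub (i12.const_mul 2)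
    have j2 : Integrable (fun z => f z * f z - 2 * (f z * l z) + l z * l z) ν := j1.add i22
    have j3 : Integrable (fun z => f z - l z) ν := i1.sub i2
    have j4 : Integrable (fun z => f z * f z - 2 * (f z * l z) + l z * l z - 2 * (a - b) * (f z - l z)) ν :=
      j2.sub (j3.const_mul _)
    rw [integral_add j4 (integrable_const _),
      integral_sub j2 (j3.const_mul _),
      integral_add j1 i22, integral_sub i11 (i12.const_mul 2),
      integral_const_mul, integral_const_mul, integral_sub i1 i2] at h0
    simp only [integral_const, probReal_univ, smul_eq_mul, one_mul] at h0
    change 0 ≤ A - 2 * B + D - 2 * (a - b) * (a - b) + (a - b) ^ 2 at h0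
    linarith
  have e4 : B - a * b ≤ 1 / α := by linarith
  have f1 : ∫ z, f z * ⟪z, w⟫ ∂ν = ‖w‖ * B := by
    rw [← integral_const_mul]
    congr 1; ext z; rw [hl]; field_simp
  have f2 : ∫ z, ⟪z, w⟫ ∂ν = ‖w‖ * b := by
    rw [← integral_const_mul]
    congr 1; ext z; rw [hl]; field_simp
  rw [f1, f2]
  calc ‖w‖ * B - a * (‖w‖ * b) = ‖w‖ * (B - a * b) := by ring
    _ ≤ ‖w‖ * (1 / α) := by gcongr
    _ = _ := by ring

theorem Pot.tilt {V : EV d → ℝ} (hV : Pot V) (w : EV d) (t : ℝ) : Pot (fun z => V z - t * ⟪z, w⟫) := by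
  obtain ⟨c, C, hc, hb⟩ := hV.bd
  refine ⟨by have := hV.cont; fun_prop, c / 2, C + (t * ‖w‖) ^ 2 / (2 * c), by positivity, fun z => ?_⟩
  have h1 := hb z
  have h2 : t * ⟪z, w⟫ ≤ |t| * (‖z‖ * ‖w‖) := by
    calc t * ⟪z, w⟫ ≤ |t * ⟪z, w⟫| := le_abs_self _
      _ = |t| * |⟪z, w⟫| := abs_mul _ _
      _ ≤ _ := by gcongr; exact abs_real_inner_le_norm _ _
  have h3 : 0 ≤ (c * ‖z‖ - |t| * ‖w‖) ^ 2 / (2 * c) := by positivity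
  have h4 : (c * ‖z‖ - |t| * ‖w‖) ^ 2 / (2 * c) = c / 2 * ‖z‖ ^ 2 - |t| * (‖z‖ * ‖w‖) + (t * ‖w‖) ^ 2 / (2 * c) := by
    field_simp
    rw [← sq_abs t]
    ring
  linarith

theorem SC.tilt {V : EV d → ℝ} {α : ℝ} (hV : SC α V) (w : EV d) (t : ℝ) :
    SC α (fun z => V z - t * ⟪z, w⟫) := by
  intro x y
  have := hV x y
  simp only [inner_smul_left, inner_add_left]
  simp only [conj_trivial]
  linarith

theorem tilt_deriv {V : EV d → ℝ} (hV : Pot V) {g : EV d → ℝ} (hg : EG g) (w : EV d) (t : ℝ) :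
    HasDerivAt (fun t => ∫ z, g z * Real.exp (-(V z - t * ⟪z, w⟫)))
      (∫ z, (g z * ⟪z, w⟫) * Real.exp (-(V z - t * ⟪z, w⟫))) t := by
  have hVc := hV.cont
  have hgc := hg.cont
  have hn : LipschitzWith 1 (fun z : EV d => ‖z‖) := lipschitzWith_one_norm
  have hbd : EG (fun z => (|g z| * (‖z‖ * ‖w‖)) * Real.exp (((|t| + 1) * ‖w‖) * ‖z‖)) := by
    refine EG.mul (EG.mul ?_ (EG.norm.mul (EG.const _))) (EG.exp_lip hn _)
    exact ⟨hgc.abs, by obtain ⟨A, B, h⟩ := hg.bd; exact ⟨A, B, by simpa using h⟩⟩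
  refine (hasDerivAt_integral_of_dominated_loc_of_deriv_le
    (F := fun t z => g z * Real.exp (-(V z - t * ⟪z, w⟫)))
    (F' := fun t z => (g z * ⟪z, w⟫) * Real.exp (-(V z - t * ⟪z, w⟫)))
    (bound := fun z => ((|g z| * (‖z‖ * ‖w‖)) * Real.exp (((|t| + 1) * ‖w‖) * ‖z‖)) * Real.exp (-V z))
    (Metric.ball_mem_nhds t one_pos) ?_ ((hV.tilt w t).int hg) ?_ ?_ (hV.int hbd) ?_).2
  · filter_upwards with s
    exact (by fun_prop : Continuous _).aestronglyMeasurable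
  · exact (by fun_prop : Continuous _).aestronglyMeasurable
  · filter_upwards with z s hs
    have hs' : |s| ≤ |t| + 1 := by
      rw [Metric.mem_ball, Real.dist_eq] at hs
      have := abs_sub_abs_le_abs_sub s t
      linarith
    have hin := abs_real_inner_le_norm z w
    rw [norm_mul, norm_mul, Real.norm_eq_abs, Real.norm_eq_abs, Real.norm_eq_abs,
      abs_of_pos (Real.exp_pos _), mul_assoc (|g z| * (‖z‖ * ‖w‖)), ← Real.exp_add]
    gcongr
    have : s * ⟪z, w⟫ ≤ (|t| + 1) * ‖w‖ * ‖z‖ := by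
      calc s * ⟪z, w⟫ ≤ |s * ⟪z, w⟫| := le_abs_self _
        _ = |s| * |⟪z, w⟫| := abs_mul _ _
        _ ≤ (|t| + 1) * (‖z‖ * ‖w‖) := by gcongr
        _ = _ := by ring
    linarith
  · filter_upwards with z s hs
    have h1 : HasDerivAt (fun s => -(V z - s * ⟪z, w⟫)) (⟪z, w⟫) s := by
      have e : (fun s : ℝ => -(V z - s * ⟪z, w⟫)) = fun s => s * ⟪z, w⟫ - V z := by
        funext s; ring
      rw [e]
      simpa using (hasDerivAt_mul_const (x := s) ⟪z, w⟫).sub_const (V z)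
    exact ((h1.exp).const_mul (g z)).congr_deriv (by ring)

theorem tilt_bound {V : EV d → ℝ} (hV : Pot V) {α : ℝ} (hα : 0 < α) (hs : SC α V)
    {f : EV d → ℝ} (hf : LipschitzWith 1 f) (w : EV d) :
    ∫ z, f z ∂(gib fun z => V z - ⟪z, w⟫) - ∫ z, f z ∂(gib V) ≤ ‖w‖ / α := by
  set H : ℝ → ℝ := fun t => ∫ z, f z ∂(gib fun z => V z - t * ⟪z, w⟫) with hH
  have hH' : H = fun t => (∫ z, f z * Real.exp (-(V z - t * ⟪z, w⟫))) /
      ∫ z, 1 * Real.exp (-(V z - t * ⟪z, w⟫)) := by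
    ext t
    rw [hH]
    dsimp
    rw [(hV.tilt w t).integral_gib]
    simp
  have hd : ∀ t, ∃ D, HasDerivAt H D t ∧ D ≤ ‖w‖ / α := by
    intro t
    have hp := (hV.tilt w t).Z_pos
    have h0 := (tilt_deriv hV (EG.lip hf) w t).div (tilt_deriv hV (EG.const 1) w t) (by simpa using hp.ne')
    rw [hH']
    refine ⟨_, h0, ?_⟩
    refine le_trans (le_of_eq ?_) (cov_bound (hV.tilt w t) hα (hs.tilt w t) hf w)
    rw [(hV.tilt w t).integral_gib, (hV.tilt w t).integral_gib, (hV.tilt w t).integral_gib]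
    simp only [one_mul]
    generalize (∫ z, f z * Real.exp (-(V z - t * ⟪z, w⟫))) = N1
    generalize (∫ z, f z * ⟪z, w⟫ * Real.exp (-(V z - t * ⟪z, w⟫))) = N2
    generalize (∫ z, ⟪z, w⟫ * Real.exp (-(V z - t * ⟪z, w⟫))) = N3
    generalize (∫ z, Real.exp (-(V z - t * ⟪z, w⟫))) = N4 at hp ⊢
    field_simp
  have hdiff : Differentiable ℝ H := fun t => by
    obtain ⟨D, h, -⟩ := hd t
    exact h.differentiableAt
  have := Convex.image_sub_le_mul_sub_of_deriv_le (convex_univ) hdiff.continuous.continuousOn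
    hdiff.differentiableOn (C := ‖w‖ / α) (fun t _ => by
      obtain ⟨D, h, hle⟩ := hd t
      rw [h.deriv]; exact hle) 0 (Set.mem_univ _) 1 (Set.mem_univ _) zero_le_one
  simpa [hH] using this

end PartCC

section PartD
open MeasureTheory
open scoped ENNReal RealInnerProductSpace
variable {d : ℕ}

/-- standing assumptions -/
structure Hyp (U : EV d → ℝ) (m M : ℝ) (θs : EV d) : Prop where
  hm : 0 < m
  hM : 0 ≤ M
  hC2 : ContDiff ℝ 2 U
  hHess : ∀ (z v : EV d), |⟪v, fderiv ℝ (gradient U) z v⟫| ≤ M * ‖v‖ ^ 2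
  hsc : ConvexOn ℝ Set.univ fun z => U z - m / 2 * ‖z‖ ^ 2
  hmin : ∀ θ, U θs ≤ U θ

theorem half_norm (x y : EV d) :
    ‖(1/2:ℝ) • (x + y)‖ ^ 2 = (‖x‖ ^ 2 + ‖y‖ ^ 2) / 2 - 1 / 4 * ‖x - y‖ ^ 2 := by
  rw [norm_smul, mul_pow, norm_add_sq_real, norm_sub_sq_real]
  norm_num
  ring

theorem sc_of_convex {U : EV d → ℝ} {m : ℝ}
    (hsc : ConvexOn ℝ Set.univ fun z => U z - m / 2 * ‖z‖ ^ 2) : SC m U := by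
  intro x y
  have := hsc.2 (Set.mem_univ x) (Set.mem_univ y) (show (0:ℝ) ≤ 1/2 by norm_num) (show (0:ℝ) ≤ 1/2 by norm_num) (by norm_num)
  rw [← smul_add] at this
  simp only [smul_eq_mul] at this
  rw [half_norm] at this
  linarith

theorem first_order {U : EV d → ℝ} {m : ℝ} (hU : Differentiable ℝ U)
    (hsc : ConvexOn ℝ Set.univ fun z => U z - m / 2 * ‖z‖ ^ 2) (x y : EV d) :
    U x + fderiv ℝ U x (y - x) + m / 2 * ‖y - x‖ ^ 2 ≤ U y := by
  set c : ℝ → EV d := fun s => x + s • (y - x) with hc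
  set h : ℝ → ℝ := fun s => U (c s) - m / 2 * ‖c s‖ ^ 2 with hh
  have hconv : ConvexOn ℝ Set.univ h := by
    have := hsc.comp_affineMap (AffineMap.lineMap x y : ℝ →ᵃ[ℝ] EV d)
    rw [Set.preimage_univ] at this
    have e : h = ((fun z => U z - m / 2 * ‖z‖ ^ 2) ∘ (AffineMap.lineMap x y : ℝ →ᵃ[ℝ] EV d)) := by
      ext s
      simp [hh, hc, AffineMap.lineMap_apply, add_comm]
    rw [e]
    exact this
  have hcd : HasDerivAt c (y - x) 0 := by
    have := ((hasDerivAt_id (0:ℝ)).smul_const (y - x)).const_add x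
    rw [one_smul] at this
    exact this
  have c0 : c 0 = x := by simp [hc]
  have c1 : c 1 = y := by simp [hc]
  have hd : HasDerivAt h (fderiv ℝ U x (y - x) - m / 2 * (2 * ⟪x, y - x⟫)) 0 := by
    have h1 : HasDerivAt (fun s => U (c s)) (fderiv ℝ U x (y - x)) 0 := by
      have := (hU (c 0)).hasFDerivAt.comp_hasDerivAt (0:ℝ) hcd
      rw [c0] at this
      exact this
    have h2 := hcd.norm_sq
    rw [c0] at h2
    exact h1.sub (h2.const_mul _)
  have := hconv.le_slope_of_hasDerivAt (Set.mem_univ 0) (Set.mem_univ 1) one_pos hd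
  rw [slope_def_field, hh] at this
  dsimp at this
  rw [c0, c1] at this
  have e : ‖y - x‖ ^ 2 = ‖y‖ ^ 2 - ‖x‖ ^ 2 - 2 * ⟪x, y - x⟫ := by
    rw [norm_sub_sq_real, inner_sub_right, real_inner_self_eq_norm_sq, real_inner_comm]; ring
  rw [e]
  simp only [sub_zero, div_one] at this
  linarith

namespace Hyp
variable {U : EV d → ℝ} {m M : ℝ} {θs : EV d}

theorem diff (h : Hyp U m M θs) : Differentiable ℝ U := h.hC2.differentiable (by norm_num)

theorem fzero (h : Hyp U m M θs) : fderiv ℝ U θs = 0 :=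
  IsLocalMin.fderiv_eq_zero (Filter.Eventually.of_forall h.hmin)

theorem quad (h : Hyp U m M θs) (x : EV d) : U θs + m / 2 * ‖x - θs‖ ^ 2 ≤ U x := by
  have := first_order h.diff h.hsc θs x
  rw [h.fzero] at this
  simpa using this

theorem mono (h : Hyp U m M θs) (x : EV d) : m * ‖x - θs‖ ^ 2 ≤ fderiv ℝ U x (x - θs) := by
  have h1 := first_order h.diff h.hsc x θs
  have h2 := h.quad x
  rw [norm_sub_rev θs x, ← neg_sub x θs, map_neg] at h1
  linarith

theorem pot (h : Hyp U m M θs) : Pot U := by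
  have hm := h.hm
  refine ⟨h.diff.continuous, m / 4, m / 2 * ‖θs‖ ^ 2 - U θs, by positivity, fun z => ?_⟩
  have h1 := h.quad z
  have h2 : ‖z‖ ≤ ‖z - θs‖ + ‖θs‖ := by simpa using norm_add_le (z - θs) θs
  have h3 : ‖z‖ ^ 2 ≤ 2 * ‖z - θs‖ ^ 2 + 2 * ‖θs‖ ^ 2 := by
    nlinarith [norm_nonneg z, norm_nonneg θs, norm_nonneg (z - θs), sq_nonneg (‖z - θs‖ - ‖θs‖)]
  nlinarith

theorem sc (h : Hyp U m M θs) : SC m U := sc_of_convex h.hsc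

theorem dfd (h : Hyp U m M θs) : ContDiff ℝ 1 (fderiv ℝ U) := h.hC2.fderiv_right (m := 1) (by norm_num)

theorem hess_eq (h : Hyp U m M θs) (z u v : EV d) :
    ⟪u, fderiv ℝ (gradient U) z v⟫ = fderiv ℝ (fderiv ℝ U) z v u := by
  have h1 : Differentiable ℝ (fderiv ℝ U) := h.dfd.differentiable (by norm_num)
  let T : StrongDual ℝ (EV d) ≃ₗᵢ[ℝ] EV d := (InnerProductSpace.toDual ℝ (EV d)).symm
  have e : gradient U = T ∘ fderiv ℝ U := rfl
  have h2 : HasFDerivAt (gradient U) ((T : StrongDual ℝ (EV d) →L[ℝ] EV d).comp (fderiv ℝ (fderiv ℝ U) z)) z := by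
    rw [e]
    exact T.toContinuousLinearEquiv.hasFDerivAt.comp z (h1 z).hasFDerivAt
  rw [h2.fderiv, real_inner_comm]
  change ⟪(InnerProductSpace.toDual ℝ (EV d)).symm (fderiv ℝ (fderiv ℝ U) z v), u⟫ = _
  simp

theorem hess_bd (h : Hyp U m M θs) (z v : EV d) : |fderiv ℝ (fderiv ℝ U) z v v| ≤ M * ‖v‖ ^ 2 := by
  rw [← h.hess_eq]
  exact h.hHess z v

theorem hess_bd2 (h : Hyp U m M θs) (z u v : EV d) :
    |fderiv ℝ (fderiv ℝ U) z v u| ≤ M / 2 * (‖u‖ ^ 2 + ‖v‖ ^ 2) := by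
  have hs : IsSymmSndFDerivAt ℝ U z := h.hC2.contDiffAt.isSymmSndFDerivAt (by simp)
  have h0 := hs u v
  have h1 := h.hess_bd z (u + v)
  have h2 := h.hess_bd z (u - v)
  have e : ‖u + v‖ ^ 2 + ‖u - v‖ ^ 2 = 2 * (‖u‖ ^ 2 + ‖v‖ ^ 2) := by
    rw [norm_add_sq_real, norm_sub_sq_real]; ring
  simp only [map_add, map_sub, add_apply, sub_apply] at h1 h2
  rw [h0] at h1 h2
  have e' : M * ‖u + v‖ ^ 2 + M * ‖u - v‖ ^ 2 = 2 * M * (‖u‖ ^ 2 + ‖v‖ ^ 2) := by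
    rw [← mul_add, e]; ring
  rw [abs_le] at *
  constructor <;> linarith [h1.1, h1.2, h2.1, h2.2]

theorem hess_bd3 (h : Hyp U m M θs) (z u v : EV d) :
    |fderiv ℝ (fderiv ℝ U) z v u| ≤ M / 2 * (‖u‖ ^ 2 + 1) * ‖v‖ := by
  by_cases hv : v = 0
  · simp [hv]
  have hv0 : 0 < ‖v‖ := norm_pos_iff.2 hv
  have h1 := h.hess_bd2 z u (‖v‖⁻¹ • v)
  rw [map_smul, smul_apply, norm_smul, norm_inv, norm_norm,
    inv_mul_cancel₀ hv0.ne', smul_eq_mul, abs_mul, abs_of_pos (by positivity), inv_mul_le_iff₀ hv0] at h1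
  linarith

theorem dfe (h : Hyp U m M θs) (e x : EV d) :
    HasFDerivAt (fun y => fderiv ℝ U y e) ((fderiv ℝ (fderiv ℝ U) x).flip e) x := by
  have h1 : Differentiable ℝ (fderiv ℝ U) := h.dfd.differentiable (by norm_num)
  have := (h1 x).hasFDerivAt.clm_apply (hasFDerivAt_const e x)
  exact this.congr_fderiv (by ext v; simp)

theorem lip_fd (h : Hyp U m M θs) (e : EV d) : ∃ K : NNReal, LipschitzWith K (fun y => fderiv ℝ U y e) := by
  have hM := h.hM
  have hb : 0 ≤ M / 2 * (‖e‖ ^ 2 + 1) := by positivity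
  refine ⟨Real.toNNReal (M / 2 * (‖e‖ ^ 2 + 1)), lipschitzWith_of_nnnorm_fderiv_le (𝕜 := ℝ) (fun x => (h.dfe e x).differentiableAt) fun x => ?_⟩
  rw [(h.dfe e x).fderiv]
  rw [← NNReal.coe_le_coe, Real.coe_toNNReal _ hb]
  apply ContinuousLinearMap.opNorm_le_bound _ hb
  intro v
  exact h.hess_bd3 x e v

theorem eg_fd (h : Hyp U m M θs) (e : EV d) : EG (fun y => fderiv ℝ U y e) := by
  obtain ⟨K, hK⟩ := h.lip_fd e
  exact EG.lip hK

theorem eg_hess (h : Hyp U m M θs) (e : EV d) : EG (fun y => fderiv ℝ (fun y => fderiv ℝ U y e) y e) := by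
  have e1 : (fun y => fderiv ℝ (fun y => fderiv ℝ U y e) y e) = fun y => fderiv ℝ (fderiv ℝ U) y e e := by
    ext y
    rw [(h.dfe e y).fderiv]; rfl
  rw [e1]
  refine (EG.const (M * ‖e‖ ^ 2)).of_le ?_ (fun z => h.hess_bd z e)
  have : Continuous (fderiv ℝ (fderiv ℝ U)) := h.dfd.continuous_fderiv (by norm_num)
  fun_prop

theorem ibp (h : Hyp U m M θs) {F : EV d → ℝ} (hF : Differentiable ℝ F) (e : EV d) (hF0 : EG F)
    (hF1 : EG (fun y => fderiv ℝ F y e)) :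
    ∫ x, fderiv ℝ F x e ∂(gib U) = ∫ x, F x * fderiv ℝ U x e ∂(gib U) := by
  have hd : ∀ x, HasFDerivAt (fun x => Real.exp (-U x)) (Real.exp (-U x) • (-fderiv ℝ U x)) x :=
    fun x => ((h.diff x).hasFDerivAt.neg).exp
  have hd' : ∀ x, F x * fderiv ℝ (fun x => Real.exp (-U x)) x e = -(F x * fderiv ℝ U x e * Real.exp (-U x)) := by
    intro x
    rw [(hd x).fderiv]
    simp
    ring
  have key := integral_mul_fderiv_eq_neg_fderiv_mul_of_integrable (μ := (volume : Measure (EV d)))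
    (f := F) (g := fun x => Real.exp (-U x)) (v := e)
    (h.pot.int hF1) (by
      simp only [hd']
      exact (h.pot.int (hF0.mul (h.eg_fd e))).neg) (h.pot.int hF0) (fun x _ => hF x)
      (fun x _ => (hd x).differentiableAt)
  simp only [hd', integral_neg, neg_inj] at key
  rw [h.pot.integral_gib, h.pot.integral_gib, key]

abbrev bv (i : Fin d) : EV d := EuclideanSpace.single i 1

theorem sum_bv (x : EV d) : ∑ i, x i • bv i = x := by
  have := (EuclideanSpace.basisFun (Fin d) ℝ).sum_repr x
  simpa using this

theorem moment (h : Hyp U m M θs) : ∫ x, ‖x - θs‖ ^ 2 ∂(gib U) ≤ d / m := by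
  have hm := h.hm
  have := h.pot.prob
  have l1 : ∀ i, LipschitzWith 1 (fun x : EV d => x i - θs i) := by
    intro i
    apply LipschitzWith.of_dist_le_mul
    intro x y
    rw [Real.dist_eq, dist_eq_norm]
    have := PiLp.norm_apply_le (x - y) i
    simpa using this
  have hfd : ∀ i x, fderiv ℝ (fun x : EV d => x i - θs i) x (bv i) = 1 := by
    intro i x
    have : HasFDerivAt (fun x : EV d => x i - θs i) (EuclideanSpace.proj i : EV d →L[ℝ] ℝ) x :=
      (EuclideanSpace.proj i : EV d →L[ℝ] ℝ).hasFDerivAt.sub_const _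
    rw [this.fderiv]
    simp
  have h1 : ∀ i : Fin d, 1 = ∫ x, (x i - θs i) * fderiv ℝ U x (bv i) ∂(gib U) := by
    intro i
    rw [← h.ibp (F := fun x => x i - θs i) (by fun_prop) (bv i) (EG.lip (l1 i)) (by simp only [hfd]; exact EG.const 1)]
    simp [hfd]
  have hi : ∀ i : Fin d, Integrable (fun x => (x i - θs i) * fderiv ℝ U x (bv i)) (gib U) := fun i =>
    h.pot.eg ((EG.lip (l1 i)).mul (h.eg_fd _))
  have h2 : (d : ℝ) = ∫ x, ∑ i, (x i - θs i) * fderiv ℝ U x (bv i) ∂(gib U) := by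
    rw [integral_finsetSum _ (fun i _ => hi i)]
    simp [← h1]
  have h3 : ∀ x, ∑ i, (x i - θs i) * fderiv ℝ U x (bv i) = fderiv ℝ U x (x - θs) := by
    intro x
    conv_rhs => rw [← sum_bv (x - θs)]
    simp
  simp only [h3] at h2
  have h4 : Integrable (fun x => fderiv ℝ U x (x - θs)) (gib U) := by
    simp only [← h3]
    exact integrable_finsetSum _ (fun i _ => hi i)
  have ln : LipschitzWith 1 (fun x : EV d => ‖x - θs‖) := by
    simpa [dist_eq_norm] using LipschitzWith.dist_left θs
  have h5 : Integrable (fun x => ‖x - θs‖ ^ 2) (gib U) := by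
    simp only [sq]
    exact h.pot.eg ((EG.lip ln).mul (EG.lip ln))
  rw [le_div_iff₀ hm, mul_comm, ← integral_const_mul, h2]
  exact integral_mono (h5.const_mul m) h4 (fun x => h.mono x)

theorem grad_sq (x : EV d) : ‖gradient U x‖ ^ 2 = ∑ i, fderiv ℝ U x (bv i) * fderiv ℝ U x (bv i) := by
  rw [EuclideanSpace.real_norm_sq_eq]
  congr 1
  ext i
  have : (gradient U x) i = fderiv ℝ U x (bv i) := by
    rw [← inner_gradient_left, EuclideanSpace.inner_single_right]
    simp
  rw [this, sq]

theorem grad_moment (h : Hyp U m M θs) : Integrable (fun x => ‖gradient U x‖ ^ 2) (gib U) ∧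
    ∫ x, ‖gradient U x‖ ^ 2 ∂(gib U) ≤ d * M := by
  have := h.pot.prob
  have hi : ∀ i : Fin d, Integrable (fun x => fderiv ℝ U x (bv i) * fderiv ℝ U x (bv i)) (gib U) := fun i =>
    h.pot.eg ((h.eg_fd _).mul (h.eg_fd _))
  simp only [grad_sq]
  refine ⟨integrable_finsetSum _ (fun i _ => hi i), ?_⟩
  rw [integral_finsetSum _ (fun i _ => hi i)]
  have : ∀ i : Fin d, ∫ x, fderiv ℝ U x (bv i) * fderiv ℝ U x (bv i) ∂(gib U) ≤ M := by
    intro i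
    rw [← h.ibp (F := fun x => fderiv ℝ U x (bv i)) (fun x => (h.dfe _ x).differentiableAt) _ (h.eg_fd _) (h.eg_hess _)]
    refine (integral_mono (h.pot.eg (h.eg_hess _)) (integrable_const M) fun x => ?_).trans (by simp)
    dsimp
    rw [(h.dfe _ x).fderiv]
    have := (abs_le.1 (h.hess_bd x (bv i))).2
    simpa [bv] using this
  refine (Finset.sum_le_sum fun i _ => this i).trans (by simp)

end Hyp

end PartD

section PartE1
open MeasureTheory
open scoped ENNReal RealInnerProductSpace
variable {d : ℕ}

/-- Lipschitz Markov kernels -/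
structure LK (κ : EV d → Measure (EV d)) (L : NNReal) : Prop where
  meas : Measurable κ
  good : ∀ x, Good (κ x)
  lip : ∀ (f : EV d → ℝ) (K : NNReal), LipschitzWith K f → LipschitzWith (L * K) (fun x => ∫ y, f y ∂(κ x))

theorem LK.of_one {κ : EV d → Measure (EV d)} {L : NNReal} (h1 : Measurable κ) (h2 : ∀ x, Good (κ x))
    (h3 : ∀ f : EV d → ℝ, LipschitzWith 1 f → ∀ x y, ∫ z, f z ∂(κ x) - ∫ z, f z ∂(κ y) ≤ L * ‖x - y‖) :
    LK κ L := by
  refine ⟨h1, h2, fun f K hf => ?_⟩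
  apply LipschitzWith.of_dist_le_mul
  by_cases hK : K = 0
  · have : ∀ x, f x = f 0 := by
      intro x
      have := hf.dist_le_mul x 0
      rw [hK] at this
      simp only [NNReal.coe_zero, zero_mul] at this
      exact dist_le_zero.1 this
    have hc : f = fun _ => f 0 := funext this
    intro x y
    have := (h2 x).1
    have := (h2 y).1
    rw [hc, hK]
    simp
  have hK0 : (0:ℝ) < K := by
    have := pos_of_ne_zero hK
    exact_mod_cast this
  have hg : LipschitzWith 1 (fun x => (K:ℝ)⁻¹ * f x) := by
    apply LipschitzWith.of_dist_le_mul
    intro x y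
    have h := hf.dist_le_mul x y
    rw [Real.dist_eq] at *
    rw [← mul_sub, abs_mul, abs_of_pos (by positivity), inv_mul_le_iff₀ hK0]
    simpa using h
  have key : ∀ x y, ∫ z, f z ∂(κ x) - ∫ z, f z ∂(κ y) ≤ L * K * ‖x - y‖ := by
    intro x y
    have := h3 _ hg x y
    rw [integral_const_mul, integral_const_mul, ← mul_sub, inv_mul_le_iff₀ hK0] at this
    linarith
  intro x y
  rw [Real.dist_eq, dist_eq_norm, abs_le]
  push_cast
  have k1 := key x y
  have k2 := key y x
  rw [norm_sub_rev] at k2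
  constructor <;> linarith

theorem LK.bind_aux {κ : EV d → Measure (EV d)} {L : NNReal} (h : LK κ L) {μ : Measure (EV d)} (hμ : Good μ)
    (f : EV d → ℝ) (K : NNReal) (hf : LipschitzWith K f) :
    Integrable f (μ.bind κ) ∧ ∫ y, f y ∂(μ.bind κ) = ∫ x, ∫ y, f y ∂(κ x) ∂μ := by
  have := hμ.1
  have i2 := fun x => (h.good x).1
  let κ' : ProbabilityTheory.Kernel (EV d) (EV d) := ⟨κ, h.meas⟩
  have hi : Integrable f (μ.bind κ') := by
    rw [Measure.integrable_comp_iff hf.continuous.aestronglyMeasurable]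
    refine ⟨Filter.Eventually.of_forall fun x => (h.good x).lip hf, ?_⟩
    have hn : LipschitzWith K (fun x => ‖f x‖) := by
      have := lipschitzWith_one_norm.comp hf
      rw [one_mul] at this
      exact this
    exact hμ.lip (h.lip _ K hn)
  refine ⟨hi, ?_⟩
  change ∫ y, f y ∂(μ.bind κ') = ∫ x, ∫ y, f y ∂(κ' x) ∂μ
  rw [Measure.comp_eq_comp_const_apply] at hi ⊢
  rw [ProbabilityTheory.Kernel.integral_comp hi]
  simp

theorem LK.bind_prob {κ : EV d → Measure (EV d)} {L : NNReal} (h : LK κ L) {μ : Measure (EV d)} (hμ : Good μ) :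
    IsProbabilityMeasure (μ.bind κ) := by
  have := hμ.1
  have i2 := fun x => (h.good x).1
  constructor
  rw [Measure.bind_apply MeasurableSet.univ h.meas.aemeasurable]
  simp

theorem LK.bind_good {κ : EV d → Measure (EV d)} {L : NNReal} (h : LK κ L) {μ : Measure (EV d)} (hμ : Good μ) :
    Good (μ.bind κ) :=
  ⟨h.bind_prob hμ, (h.bind_aux hμ _ 1 lipschitzWith_one_norm).1⟩

theorem LK.comp {κ η : EV d → Measure (EV d)} {L L' : NNReal} (h : LK κ L) (h' : LK η L') :
    LK (fun x => (κ x).bind η) (L * L') := by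
  refine ⟨(Measure.measurable_bind' h'.meas).comp h.meas, fun x => h'.bind_good (h.good x), fun f K hf => ?_⟩
  have : (fun x => ∫ y, f y ∂((κ x).bind η)) = fun x => ∫ z, ∫ y, f y ∂(η z) ∂(κ x) := by
    ext x
    exact (h'.bind_aux (h.good x) f K hf).2
  rw [this, mul_assoc]
  exact h.lip _ _ (h'.lip f K hf)

theorem meas_dens {h : EV d → EV d → ℝ} (hh : Measurable (Function.uncurry h)) :
    Measurable (fun θ => densMeasure (h θ)) := by
  apply Measure.measurable_of_measurable_coe
  intro s hs
  simp only [densMeasure, Measure.smul_apply, withDensity_apply _ hs, smul_eq_mul]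
  have hm : Measurable (Function.uncurry fun θ z => ENNReal.ofReal (h θ z)) := hh.ennreal_ofReal
  exact (Measurable.lintegral_prod_right hm).inv.mul (Measurable.lintegral_prod_right hm)

/-- Gaussian potential -/
def gp (ρ : ℝ) (x : EV d) : ℝ := ‖x‖ ^ 2 / (2 * ρ ^ 2)

/-- conditional potential -/
def VV (U : EV d → ℝ) (ρ : ℝ) (θ z : EV d) : ℝ := U z + ‖z - θ‖ ^ 2 / (2 * ρ ^ 2)

def Kk (U : EV d → ℝ) (ρ : ℝ) (θ : EV d) : Measure (EV d) := gib (VV U ρ θ)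

def Gk (ρ : ℝ) (z : EV d) : Measure (EV d) := gib (fun x => gp ρ (x - z))

theorem sgs_eq (U : EV d → ℝ) (ρ : ℝ) : sgsKernelId U ρ = fun θ => (Kk U ρ θ).bind (Gk ρ) := by
  funext θ
  have e : (fun z : EV d => Real.exp (-U z - ‖z - θ‖ ^ 2 / (2 * ρ ^ 2))) = fun z => Real.exp (-(VV U ρ θ z)) := by
    funext z; rw [VV, neg_add]; rfl
  rw [sgsKernelId, e]
  rfl

theorem gp_pot {ρ : ℝ} (hρ : 0 < ρ) (z : EV d) : Pot (fun x => gp ρ (x - z)) := by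
  refine ⟨by unfold gp; fun_prop, 1 / (4 * ρ ^ 2), ‖z‖ ^ 2 / (2 * ρ ^ 2), by positivity, fun x => ?_⟩
  have h2 : ‖x‖ ≤ ‖x - z‖ + ‖z‖ := by simpa using norm_add_le (x - z) z
  have h3 : ‖x‖ ^ 2 ≤ 2 * ‖x - z‖ ^ 2 + 2 * ‖z‖ ^ 2 := by
    nlinarith [norm_nonneg x, norm_nonneg z, norm_nonneg (x - z), sq_nonneg (‖x - z‖ - ‖z‖)]
  unfold gp
  have : 0 ≤ (2 * ‖x - z‖ ^ 2 + 2 * ‖z‖ ^ 2 - ‖x‖ ^ 2) / (4 * ρ ^ 2) := div_nonneg (by linarith) (by positivity)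
  have e : (2 * ‖x - z‖ ^ 2 + 2 * ‖z‖ ^ 2 - ‖x‖ ^ 2) / (4 * ρ ^ 2) =
    ‖x - z‖ ^ 2 / (2 * ρ ^ 2) + ‖z‖ ^ 2 / (2 * ρ ^ 2) - 1 / (4 * ρ ^ 2) * ‖x‖ ^ 2 := by
    field_simp
    ring
  linarith

theorem gp_pot0 {ρ : ℝ} (hρ : 0 < ρ) : Pot (gp (d := d) ρ) := by
  simpa using gp_pot hρ (0 : EV d)

theorem VV_pot {U : EV d → ℝ} (hU : Pot U) (ρ : ℝ) (θ : EV d) : Pot (VV U ρ θ) := by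
  obtain ⟨c, C, hc, hb⟩ := hU.bd
  refine ⟨by have := hU.cont; unfold VV; fun_prop, c, C, hc, fun z => ?_⟩
  have : 0 ≤ ‖z - θ‖ ^ 2 / (2 * ρ ^ 2) := by positivity
  unfold VV
  linarith [hb z]

theorem VV_sc {U : EV d → ℝ} {m : ℝ} (hU : SC m U) (ρ : ℝ) (θ : EV d) : SC (m + 1 / ρ ^ 2) (VV U ρ θ) := by
  intro x y
  have h1 := hU x y
  have h2 := half_norm (x - θ) (y - θ)
  have e1 : (1/2:ℝ) • (x - θ + (y - θ)) = (1/2:ℝ) • (x + y) - θ := by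
    module
  have e2 : x - θ - (y - θ) = x - y := by abel
  rw [e1, e2] at h2
  unfold VV
  rw [h2]
  have e3 : ((‖x - θ‖ ^ 2 + ‖y - θ‖ ^ 2) / 2 - 1 / 4 * ‖x - y‖ ^ 2) / (2 * ρ ^ 2) =
    (‖x - θ‖ ^ 2 / (2 * ρ ^ 2) + ‖y - θ‖ ^ 2 / (2 * ρ ^ 2)) / 2 - (1 / ρ ^ 2) / 8 * ‖x - y‖ ^ 2 := by
    ring
  rw [e3]
  linarith

theorem gib_add_const {c : ℝ} {V : EV d → ℝ} (hV : Pot V) (hV' : Pot (fun z => V z + c)) (f : EV d → ℝ) :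
    ∫ z, f z ∂(gib fun z => V z + c) = ∫ z, f z ∂(gib V) := by
  rw [hV.integral_gib, hV'.integral_gib]
  have hp := hV.Z_pos
  have e : ∀ z, Real.exp (-(V z + c)) = Real.exp (-c) * Real.exp (-V z) := by
    intro z; rw [← Real.exp_add]; congr 1; ring
  simp only [e]
  have e2 : ∀ z, f z * (Real.exp (-c) * Real.exp (-V z)) = Real.exp (-c) * (f z * Real.exp (-V z)) := by
    intro z; ring
  simp only [e2]
  rw [integral_const_mul, integral_const_mul, mul_div_mul_left _ _ (Real.exp_pos _).ne']

theorem VV_shift (U : EV d → ℝ) (ρ : ℝ) (θ θ' : EV d) :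
    VV U ρ θ' = fun z => (VV U ρ θ z - ⟪z, (1 / ρ ^ 2) • (θ' - θ)⟫) + (‖θ'‖ ^ 2 - ‖θ‖ ^ 2) / (2 * ρ ^ 2) := by
  funext z
  unfold VV
  rw [norm_sub_sq_real, norm_sub_sq_real, inner_smul_right, inner_sub_right]
  ring

theorem VV_int {U : EV d → ℝ} (hU : Pot U) (ρ : ℝ) (θ θ' : EV d) (f : EV d → ℝ) :
    ∫ z, f z ∂(gib (VV U ρ θ')) = ∫ z, f z ∂(gib fun z => VV U ρ θ z - ⟪z, (1 / ρ ^ 2) • (θ' - θ)⟫) := by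
  have hp : Pot (fun z => VV U ρ θ z - ⟪z, (1 / ρ ^ 2) • (θ' - θ)⟫) := by
    have := (VV_pot hU ρ θ).tilt ((1 / ρ ^ 2) • (θ' - θ)) 1
    simp only [one_mul] at this
    exact this
  have hp' := VV_pot hU ρ θ'
  rw [VV_shift U ρ θ θ'] at hp'
  rw [← gib_add_const hp hp', ← VV_shift U ρ θ θ']

theorem K_LK {U : EV d → ℝ} {m : ℝ} (hm : 0 < m) (hU : Pot U) (hs : SC m U) {ρ : ℝ} (hρ : 0 < ρ) :
    LK (Kk U ρ) (Real.toNNReal (1 / (1 + m * ρ ^ 2))) := by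
  refine LK.of_one ?_ (fun θ => (VV_pot hU ρ θ).good) ?_
  · have hUc := hU.cont
    apply meas_dens
    unfold VV
    exact (by fun_prop : Continuous _).measurable
  · intro f hf θ' θ
    rw [Real.coe_toNNReal _ (by positivity)]
    unfold Kk
    rw [VV_int hU ρ θ θ']
    refine (tilt_bound (VV_pot hU ρ θ) (α := m + 1 / ρ ^ 2) (by positivity) (VV_sc hs ρ θ) hf _).trans (le_of_eq ?_)
    rw [norm_smul, Real.norm_eq_abs, abs_of_pos (by positivity)]
    field_simp
    ring

theorem G_int {ρ : ℝ} (hρ : 0 < ρ) (f : EV d → ℝ) (z : EV d) :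
    ∫ x, f x ∂(Gk ρ z) = ∫ x, f (z + x) ∂(gib (gp ρ)) := by
  rw [Gk, (gp_pot hρ z).integral_gib, (gp_pot0 hρ).integral_gib,
    ← integral_add_left_eq_self (fun x => f x * Real.exp (-gp ρ (x - z))) z,
    ← integral_add_left_eq_self (fun x => Real.exp (-gp ρ (x - z))) z]
  simp

theorem G_LK {ρ : ℝ} (hρ : 0 < ρ) : LK (d := d) (Gk ρ) 1 := by
  refine LK.of_one ?_ (fun z => (gp_pot hρ z).good) ?_
  · apply meas_dens
    unfold gp
    exact (by fun_prop : Continuous _).measurable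
  · intro f hf x y
    have hp := (gp_pot0 (d := d) hρ).prob
    have hl : ∀ z, LipschitzWith 1 (fun x => f (z + x)) := by
      intro z
      apply LipschitzWith.of_dist_le_mul
      intro x y
      simpa using hf.dist_le_mul (z + x) (z + y)
    have i := fun z => (gp_pot0 (d := d) hρ).eg (EG.lip (hl z))
    rw [G_int hρ, G_int hρ, ← integral_sub (i x) (i y)]
    refine (integral_mono ((i x).sub (i y)) (integrable_const (‖x - y‖)) fun ξ => ?_).trans (by simp)
    have := hf.dist_le_mul (x + ξ) (y + ξ)
    rw [Real.dist_eq, dist_eq_norm] at this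
    simp only [NNReal.coe_one, one_mul, add_sub_add_right_eq_sub] at this
    exact (le_abs_self _).trans this

theorem lint_gib {V : EV d → ℝ} (hV : Pot V) (f : EV d → ℝ≥0∞) :
    ∫⁻ z, f z ∂(gib V) = (∫⁻ z, ENNReal.ofReal (Real.exp (-V z)))⁻¹ * ∫⁻ z, ENNReal.ofReal (Real.exp (-V z)) * f z := by
  have := hV.cont
  rw [gib, densMeasure, lintegral_smul_measure, smul_eq_mul, lintegral_withDensity_eq_lintegral_mul_non_measurable _ (by fun_prop) (by simp)]
  rfl

theorem invariant {U : EV d → ℝ} (hU : Pot U) {ρ : ℝ} (hρ : 0 < ρ) :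
    ((gib U).bind (Gk ρ)).bind (Kk U ρ) = gib U := by
  have hUc := hU.cont
  have mG : Measurable (Gk (d := d) ρ) := (G_LK hρ).meas
  have mK : Measurable (Kk U ρ) := by
    apply meas_dens
    unfold VV
    exact (by fun_prop : Continuous _).measurable
  set p : EV d → ℝ≥0∞ := fun z => ENNReal.ofReal (Real.exp (-U z)) with hp
  set φ : EV d → ℝ≥0∞ := fun z => ENNReal.ofReal (Real.exp (-gp ρ z)) with hφ
  have mp : Measurable p := by fun_prop
  have mφ : Measurable φ := by
    have : Measurable (gp (d := d) ρ) := (gp_pot0 hρ).cont.measurable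
    fun_prop
  have hφn : ∀ x y, φ (x - y) = φ (y - x) := by
    intro x y; simp only [hφ, gp, norm_sub_rev]
  have hV : ∀ θ z, ENNReal.ofReal (Real.exp (-VV U ρ θ z)) = p z * φ (z - θ) := by
    intro θ z
    simp only [hp, hφ, gp, VV]
    rw [← ENNReal.ofReal_mul (Real.exp_pos _).le, ← Real.exp_add]
    congr 2; ring
  set Z := ∫⁻ z, φ z with hZ
  have hZ0 : Z ≠ 0 := by
    rw [hZ, hφ, (gp_pot0 hρ).lint]
    simpa using (gp_pot0 hρ).Z_pos
  have hZt : Z ≠ ∞ := by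
    rw [hZ, hφ, (gp_pot0 hρ).lint]
    simp
  have hGZ : ∀ z, ∫⁻ x, φ (x - z) = Z := fun z => lintegral_sub_right_eq_self φ z
  have hGZ' : ∀ z, ∫⁻ x, φ (z - x) = Z := fun z => by simp only [hφn z]; exact hGZ z
  set q : EV d → ℝ≥0∞ := fun θ => ∫⁻ z, p z * φ (z - θ) with hq
  have hq' : ∀ θ, q θ = ENNReal.ofReal (∫ z, Real.exp (-VV U ρ θ z)) := by
    intro θ
    rw [← (VV_pot hU ρ θ).lint]
    simp only [hV, hq]
  have hq0 : ∀ θ, q θ ≠ 0 := fun θ => by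
    rw [hq']; simpa using (VV_pot hU ρ θ).Z_pos
  have hqt : ∀ θ, q θ ≠ ∞ := fun θ => by
    rw [hq']; simp
  have mq : Measurable q := by
    apply Measurable.lintegral_prod_right (f := fun θ z => p z * φ (z - θ))
    fun_prop
  ext s hs
  set r : EV d → ℝ≥0∞ := fun θ => ∫⁻ z in s, p z * φ (z - θ) with hr
  have mr : Measurable r := by
    apply Measurable.lintegral_prod_right (f := fun θ z => p z * φ (z - θ))
    fun_prop
  have hK : ∀ θ, Kk U ρ θ s = (q θ)⁻¹ * r θ := by
    intro θ
    rw [Kk, gib, densMeasure, Measure.smul_apply, withDensity_apply _ hs, smul_eq_mul]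
    simp only [hV, hq, hr]
  rw [Measure.bind_apply hs mK.aemeasurable, Measure.lintegral_bind mG.aemeasurable
    (f := fun a => Kk U ρ a s) (Measure.measurable_coe hs |>.comp mK).aemeasurable]
  simp only [hK]
  have hG : ∀ z, ∫⁻ θ, (q θ)⁻¹ * r θ ∂(Gk ρ z) = Z⁻¹ * ∫⁻ θ, φ (θ - z) * ((q θ)⁻¹ * r θ) := by
    intro z
    rw [Gk, lint_gib (gp_pot hρ z)]
    change (∫⁻ x, φ (x - z))⁻¹ * ∫⁻ θ, φ (θ - z) * _ = _
    rw [hGZ]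
  simp only [hG]
  rw [lint_gib hU]
  change (∫⁻ z, p z)⁻¹ * ∫⁻ z, p z * (Z⁻¹ * ∫⁻ θ, φ (θ - z) * ((q θ)⁻¹ * r θ)) = _
  rw [gib, densMeasure, Measure.smul_apply, withDensity_apply _ hs, smul_eq_mul]
  change _ = (∫⁻ z, p z)⁻¹ * ∫⁻ z in s, p z
  congr 1
  calc ∫⁻ z, p z * (Z⁻¹ * ∫⁻ θ, φ (θ - z) * ((q θ)⁻¹ * r θ))
      = ∫⁻ z, ∫⁻ θ, Z⁻¹ * (((q θ)⁻¹ * r θ) * (p z * φ (z - θ))) := by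
        refine lintegral_congr fun z => ?_
        rw [← lintegral_const_mul _ (by fun_prop), ← lintegral_const_mul _ (by fun_prop)]
        refine lintegral_congr fun θ => ?_
        rw [hφn]; ring
    _ = ∫⁻ θ, ∫⁻ z, Z⁻¹ * (((q θ)⁻¹ * r θ) * (p z * φ (z - θ))) := by
        apply lintegral_lintegral_swap
        apply Measurable.aemeasurable
        fun_prop
    _ = ∫⁻ θ, Z⁻¹ * r θ := by
        refine lintegral_congr fun θ => ?_
        rw [lintegral_const_mul _ (by fun_prop), lintegral_const_mul _ (by fun_prop)]
        change Z⁻¹ * ((q θ)⁻¹ * r θ * q θ) = _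
        rw [mul_right_comm, ENNReal.inv_mul_cancel (hq0 θ) (hqt θ), one_mul]
    _ = Z⁻¹ * ∫⁻ θ, ∫⁻ z in s, p z * φ (z - θ) := by
        rw [lintegral_const_mul _ mr]
    _ = Z⁻¹ * ∫⁻ z in s, ∫⁻ θ, p z * φ (z - θ) := by
        congr 1
        apply lintegral_lintegral_swap
        apply Measurable.aemeasurable
        fun_prop
    _ = Z⁻¹ * ∫⁻ z in s, p z * Z := by
        congr 1
        refine lintegral_congr fun z => ?_
        rw [lintegral_const_mul _ (by fun_prop), hGZ']
    _ = ∫⁻ z in s, p z := by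
        rw [lintegral_mul_const _ mp, mul_comm, mul_assoc, ENNReal.mul_inv_cancel hZ0 hZt, mul_one]

end PartE1

section PartF
open MeasureTheory
open scoped ENNReal RealInnerProductSpace
variable {d : ℕ}

theorem gp_hasGrad {ρ : ℝ} (x : EV d) : HasGradientAt (gp ρ) ((1 / ρ ^ 2) • x) x := by
  rw [hasGradientAt_iff_hasFDerivAt]
  have h := ((hasStrictFDerivAt_norm_sq x).hasFDerivAt).mul_const ((2 * ρ ^ 2)⁻¹)
  have e : (gp ρ : EV d → ℝ) = fun x => ‖x‖ ^ 2 * (2 * ρ ^ 2)⁻¹ := by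
    ext x; rw [gp, div_eq_mul_inv]
  rw [e]
  refine h.congr_fderiv ?_
  ext v
  simp
  ring

theorem gp_hyp {ρ : ℝ} (hρ : 0 < ρ) : Hyp (gp (d := d) ρ) (1 / ρ ^ 2) (1 / ρ ^ 2) 0 := by
  refine ⟨by positivity, by positivity, ?_, ?_, ?_, ?_⟩
  · unfold gp
    exact (contDiff_norm_sq ℝ).div_const _
  · intro z v
    have e : gradient (gp (d := d) ρ) = fun x => (1 / ρ ^ 2) • x := by
      ext1 x
      exact (gp_hasGrad x).gradient
    rw [e]
    have : HasFDerivAt (fun x : EV d => (1 / ρ ^ 2) • x) ((1 / ρ ^ 2) • ContinuousLinearMap.id ℝ (EV d)) z :=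
      ((1 / ρ ^ 2) • ContinuousLinearMap.id ℝ (EV d)).hasFDerivAt
    rw [this.fderiv]
    simp [inner_smul_right]
  · have e : (fun z : EV d => gp ρ z - 1 / ρ ^ 2 / 2 * ‖z‖ ^ 2) = fun _ => 0 := by
      ext z
      rw [gp]; field_simp; ring
    rw [e]
    exact convexOn_const 0 convex_univ
  · intro θ
    unfold gp
    simp
    positivity

theorem cs_sqrt {μ : Measure (EV d)} [IsProbabilityMeasure μ] {g : EV d → ℝ} (i1 : Integrable g μ)
    (i2 : Integrable (fun x => g x ^ 2) μ) {c : ℝ} (h : ∫ x, g x ^ 2 ∂μ ≤ c) : ∫ x, g x ∂μ ≤ Real.sqrt c := by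
  apply Real.le_sqrt_of_sq_le
  refine le_trans ?_ h
  set a := ∫ x, g x ∂μ with ha
  have h0 : 0 ≤ ∫ x, (g x - a) ^ 2 ∂μ := integral_nonneg fun x => sq_nonneg _
  have e : (fun x => (g x - a) ^ 2) = fun x => g x ^ 2 - (2 * a) * g x + a ^ 2 := by
    ext x; ring
  have j1 : Integrable (fun x => (2 * a) * g x) μ := i1.const_mul _
  have j2 : Integrable (fun x => g x ^ 2 - (2 * a) * g x) μ := i2.sub j1
  rw [e, integral_add j2 (integrable_const _), integral_sub i2 j1, integral_const_mul, ← ha] at h0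
  simp at h0
  nlinarith

theorem EG.normsq : EG (fun z : EV d => ‖z‖ ^ 2) := by
  simpa [sq] using (EG.norm (d := d)).mul EG.norm

theorem gp_norm {ρ : ℝ} (hρ : 0 < ρ) : ∫ x : EV d, ‖x‖ ∂(gib (gp ρ)) ≤ ρ * Real.sqrt d := by
  have h := (gp_hyp (d := d) hρ).moment
  have := (gp_pot0 (d := d) hρ).prob
  have := cs_sqrt (μ := gib (gp (d := d) ρ)) (g := fun x => ‖x‖) ((gp_pot0 hρ).eg EG.norm) ((gp_pot0 hρ).eg EG.normsq)
    (c := d / (1 / ρ ^ 2)) (by simpa using h)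
  refine this.trans (le_of_eq ?_)
  rw [div_div_eq_mul_div, div_one, Real.sqrt_mul (by positivity), Real.sqrt_sq hρ.le, mul_comm]

theorem gp_mean {ρ : ℝ} (hρ : 0 < ρ) (u : EV d) : ∫ x : EV d, ⟪x, u⟫ ∂(gib (gp ρ)) = 0 := by
  rw [(gp_pot0 hρ).integral_gib]
  have := integral_neg_eq_self (fun x : EV d => ⟪x, u⟫ * Real.exp (-gp ρ x)) volume
  have e : ∀ x : EV d, ⟪-x, u⟫ * Real.exp (-gp ρ (-x)) = - (⟪x, u⟫ * Real.exp (-gp ρ x)) := by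
    intro x
    simp [gp]
  simp only [e, integral_neg] at this
  have : ∫ x : EV d, ⟪x, u⟫ * Real.exp (-gp ρ x) = 0 := by linarith
  rw [this, zero_div]

theorem gp_cov {ρ : ℝ} (hρ : 0 < ρ) {f : EV d → ℝ} (hf : LipschitzWith 1 f) (x u : EV d) {s : ℝ} (hs : 0 ≤ s) :
    ∫ ξ : EV d, f (x + s • ξ) * ⟪ξ, u⟫ ∂(gib (gp ρ)) ≤ s * ρ ^ 2 * ‖u‖ := by
  rcases hs.eq_or_lt with rfl | hs
  · simp only [zero_smul, add_zero, integral_const_mul, gp_mean hρ]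
    simp
  have hg : LipschitzWith 1 (fun ξ => s⁻¹ * f (x + s • ξ)) := by
    apply LipschitzWith.of_dist_le_mul
    intro a b
    have h := hf.dist_le_mul (x + s • a) (x + s • b)
    rw [dist_add_left, dist_smul₀, Real.norm_of_nonneg hs.le] at h
    rw [Real.dist_eq] at *
    rw [← mul_sub, abs_mul, abs_of_pos (by positivity), inv_mul_le_iff₀ hs]
    simpa using h
  have := cov_bound (gp_pot0 hρ) (α := 1 / ρ ^ 2) (by positivity) (gp_hyp hρ).sc hg u
  rw [gp_mean hρ] at this
  simp only [mul_assoc, integral_const_mul] at this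
  rw [mul_zero, mul_zero, sub_zero, inv_mul_le_iff₀ hs] at this
  refine this.trans (le_of_eq ?_)
  field_simp

end PartF

section PartH
open MeasureTheory
open scoped ENNReal RealInnerProductSpace
variable {d : ℕ}

theorem EG.sum {ι : Type} (s : Finset ι) {g : ι → EV d → ℝ} (h : ∀ i, EG (g i)) : EG (fun z => ∑ i ∈ s, g i z) := by
  classical
  induction s using Finset.induction_on with
  | empty => simpa using EG.const (d := d) 0
  | insert a s ha ih =>
    simp only [Finset.sum_insert ha]
    exact (h a).add ih

theorem Hyp.grad_cont {U : EV d → ℝ} {m M : ℝ} {θs : EV d} (h : Hyp U m M θs) : Continuous (gradient U) :=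
  (InnerProductSpace.toDual ℝ (EV d)).symm.continuous.comp h.dfd.continuous

theorem Hyp.grad_eg {U : EV d → ℝ} {m M : ℝ} {θs : EV d} (h : Hyp U m M θs) : EG (fun x => ‖gradient U x‖) := by
  have h2 := EG.sum Finset.univ (fun i : Fin d => (h.eg_fd (Hyp.bv i)).mul (h.eg_fd (Hyp.bv i)))
  refine ((EG.const 1).add h2).of_le h.grad_cont.norm fun z => ?_
  rw [← Hyp.grad_sq, abs_of_nonneg (norm_nonneg _)]
  nlinarith [sq_nonneg (‖gradient U z‖ - 1)]

theorem Hyp.grad_mean {U : EV d → ℝ} {m M : ℝ} {θs : EV d} (h : Hyp U m M θs) :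
    ∫ x, ‖gradient U x‖ ∂(gib U) ≤ Real.sqrt (d * M) := by
  have := h.pot.prob
  exact cs_sqrt (h.pot.eg h.grad_eg) h.grad_moment.1 h.grad_moment.2

section bias
variable {U : EV d → ℝ} {m M : ℝ} {θs : EV d} {ρ : ℝ}

theorem lip_abs {f : EV d → ℝ} (hf : LipschitzWith 1 f) (x y : EV d) : |f x - f y| ≤ ‖x - y‖ := by
  have := hf.dist_le_mul x y
  rw [Real.dist_eq, dist_eq_norm] at this
  simpa using this

theorem lip_shift {f : EV d → ℝ} (hf : LipschitzWith 1 f) (x ξ : EV d) (s : ℝ) :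
    |f (x + s • ξ)| ≤ (|f 0| + ‖x‖) + |s| * ‖ξ‖ := by
  have h1 := lip_abs hf (x + s • ξ) 0
  have h2 := norm_add_le x (s • ξ)
  rw [norm_smul, Real.norm_eq_abs] at h2
  rw [sub_zero] at h1
  have h3 := abs_sub_abs_le_abs_sub (f (x + s • ξ)) (f 0)
  linarith

theorem int_shift (hU : Pot U) (hρ : 0 < ρ) {f : EV d → ℝ} (hf : LipschitzWith 1 f) (s : ℝ) :
    Integrable (fun p : EV d × EV d => f (p.1 + s • p.2)) ((gib U).prod (gib (gp ρ))) := by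
  have := hU.prob
  have := (gp_pot0 (d := d) hρ).prob
  have i1 : Integrable (fun p : EV d × EV d => |f 0| + ‖p.1‖) ((gib U).prod (gib (gp ρ))) :=
    (hU.eg ((EG.const |f 0|).add EG.norm)).comp_fst _
  have i2 : Integrable (fun p : EV d × EV d => |s| * ‖p.2‖) ((gib U).prod (gib (gp ρ))) :=
    ((gp_pot0 hρ).eg ((EG.const |s|).mul EG.norm)).comp_snd _
  refine (i1.add i2).mono' ?_ (Filter.Eventually.of_forall fun p => lip_shift hf p.1 p.2 s)
  have := hf.continuous
  exact (by fun_prop : Continuous _).aestronglyMeasurable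

theorem fd_bd {f : EV d → ℝ} (hf : LipschitzWith 1 f) (y ξ : EV d) : ‖fderiv ℝ f y ξ‖ ≤ ‖ξ‖ := by
  have h := norm_fderiv_le_of_lipschitz ℝ hf (x₀ := y)
  have := (fderiv ℝ f y).le_of_opNorm_le h ξ
  simpa using this

theorem J_deriv (hU : Pot U) (hρ : 0 < ρ) {f : EV d → ℝ} (hf : LipschitzWith 1 f) (hf1 : ContDiff ℝ 1 f) (s : ℝ) :
    Integrable (fun p : EV d × EV d => fderiv ℝ f (p.1 + s • p.2) p.2) ((gib U).prod (gib (gp ρ))) ∧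
    HasDerivAt (fun s : ℝ => ∫ p : EV d × EV d, f (p.1 + s • p.2) ∂((gib U).prod (gib (gp ρ))))
      (∫ p : EV d × EV d, fderiv ℝ f (p.1 + s • p.2) p.2 ∂((gib U).prod (gib (gp ρ)))) s := by
  have := hU.prob
  have := (gp_pot0 (d := d) hρ).prob
  have hc : Continuous (fderiv ℝ f) := hf1.continuous_fderiv (by norm_num)
  have hc0 := hf.continuous
  refine hasDerivAt_integral_of_dominated_loc_of_deriv_le
    (F := fun s (p : EV d × EV d) => f (p.1 + s • p.2)) (F' := fun s (p : EV d × EV d) => fderiv ℝ f (p.1 + s • p.2) p.2)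
    (bound := fun p => ‖p.2‖) (s := Set.univ) Filter.univ_mem ?_ (int_shift hU hρ hf s) ?_ ?_ ?_ ?_
  · exact Filter.Eventually.of_forall fun s => (int_shift hU hρ hf s).1
  · have h1 : Continuous (fun p : EV d × EV d => p.1 + s • p.2) := by fun_prop
    exact ((hc.comp h1).clm_apply continuous_snd).aestronglyMeasurable
  · exact Filter.Eventually.of_forall fun p s _ => fd_bd hf _ _
  · exact ((gp_pot0 hρ).eg EG.norm).comp_snd _
  · refine Filter.Eventually.of_forall fun p s _ => ?_
    have h1 : HasDerivAt (fun s : ℝ => p.1 + s • p.2) p.2 s := by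
      simpa using ((hasDerivAt_id s).smul_const p.2).const_add p.1
    exact ((hf1.differentiable (by norm_num)) _).hasFDerivAt.comp_hasDerivAt s h1

theorem J_le (h : Hyp U m M θs) (hρ : 0 < ρ) {f : EV d → ℝ} (hf : LipschitzWith 1 f) (hf1 : ContDiff ℝ 1 f)
    {s : ℝ} (hs : 0 ≤ s) :
    ∫ p : EV d × EV d, fderiv ℝ f (p.1 + s • p.2) p.2 ∂((gib U).prod (gib (gp ρ))) ≤ s * (ρ ^ 2 * Real.sqrt (d * M)) := by
  have := h.pot.prob
  have := (gp_pot0 (d := d) hρ).prob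
  have hc : Continuous (fderiv ℝ f) := hf1.continuous_fderiv (by norm_num)
  have hc0 := hf.continuous
  rw [integral_prod_symm _ (J_deriv h.pot hρ hf hf1 s).1]
  have e1 : ∀ ξ : EV d, ∫ x, fderiv ℝ f (x + s • ξ) ξ ∂(gib U) = ∫ x, f (x + s • ξ) * ⟪ξ, gradient U x⟫ ∂(gib U) := by
    intro ξ
    have hl : LipschitzWith 1 (fun x => f (x + s • ξ)) := by
      apply LipschitzWith.of_dist_le_mul
      intro x y
      simpa using hf.dist_le_mul (x + s • ξ) (y + s • ξ)
    have hd : Differentiable ℝ (fun x => f (x + s • ξ)) := (hf1.differentiable (by norm_num)).comp (by fun_prop)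
    have hfd : ∀ x, fderiv ℝ (fun x => f (x + s • ξ)) x = fderiv ℝ f (x + s • ξ) := fun x => by
      rw [fderiv_comp_add_right]
    have hE : EG (fun x => fderiv ℝ (fun x => f (x + s • ξ)) x ξ) := by
      simp only [hfd]
      refine (EG.const ‖ξ‖).of_le ?_ fun z => fd_bd hf _ _
      have h1 : Continuous (fun x : EV d => x + s • ξ) := by fun_prop
      exact (hc.comp h1).clm_apply continuous_const
    have := h.ibp hd ξ (EG.lip hl) hE
    simp only [hfd] at this
    rw [this]
    congr 1
    ext x
    rw [real_inner_comm, inner_gradient_left]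
  simp only [e1]
  have hi : Integrable (fun p : EV d × EV d => f (p.1 + s • p.2) * ⟪p.2, gradient U p.1⟫) ((gib U).prod (gib (gp ρ))) := by
    have i1 : Integrable (fun p : EV d × EV d => ((|f 0| + ‖p.1‖) * ‖gradient U p.1‖) * ‖p.2‖) ((gib U).prod (gib (gp ρ))) :=
      (h.pot.eg (((EG.const |f 0|).add EG.norm).mul h.grad_eg)).mul_prod ((gp_pot0 hρ).eg EG.norm)
    have i2 : Integrable (fun p : EV d × EV d => ‖gradient U p.1‖ * (|s| * ‖p.2‖ ^ 2)) ((gib U).prod (gib (gp ρ))) :=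
      (h.pot.eg h.grad_eg).mul_prod ((gp_pot0 hρ).eg ((EG.const |s|).mul EG.normsq))
    refine (i1.add i2).mono' ?_ (Filter.Eventually.of_forall fun p => ?_)
    · have := h.grad_cont
      exact (by fun_prop : Continuous _).aestronglyMeasurable
    · rw [norm_mul, Real.norm_eq_abs]
      have k1 := lip_shift hf p.1 p.2 s
      have k2 := norm_inner_le_norm (𝕜 := ℝ) p.2 (gradient U p.1)
      calc _ ≤ ((|f 0| + ‖p.1‖) + |s| * ‖p.2‖) * (‖p.2‖ * ‖gradient U p.1‖) := by gcongr
        _ = _ := by simp only [Pi.add_apply]; ring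
  rw [integral_integral_swap (f := fun ξ x => f (x + s • ξ) * ⟪ξ, gradient U x⟫) hi.swap]
  calc _ ≤ ∫ x, s * ρ ^ 2 * ‖gradient U x‖ ∂(gib U) := by
        refine integral_mono hi.integral_prod_left ((h.pot.eg h.grad_eg).const_mul _) fun x => gp_cov hρ hf x _ hs
    _ ≤ _ := by
        rw [integral_const_mul, mul_assoc]
        have := h.grad_mean
        gcongr

theorem bias_C1 (h : Hyp U m M θs) (hρ : 0 < ρ) {f : EV d → ℝ} (hf : LipschitzWith 1 f) (hf1 : ContDiff ℝ 1 f) :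
    ∫ p : EV d × EV d, f (p.1 + p.2) ∂((gib U).prod (gib (gp ρ))) - ∫ p : EV d × EV d, f p.1 ∂((gib U).prod (gib (gp ρ)))
      ≤ ρ ^ 2 / 2 * Real.sqrt (d * M) := by
  set J : ℝ → ℝ := fun s => ∫ p : EV d × EV d, f (p.1 + s • p.2) ∂((gib U).prod (gib (gp ρ))) with hJ
  set C := ρ ^ 2 * Real.sqrt (d * M) with hC
  have hd : ∀ s, HasDerivAt (fun s => J s - C * s ^ 2 / 2)
      (∫ p : EV d × EV d, fderiv ℝ f (p.1 + s • p.2) p.2 ∂((gib U).prod (gib (gp ρ))) - C * s) s := by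
    intro s
    refine ((J_deriv h.pot hρ hf hf1 s).2.sub ((((hasDerivAt_id s).pow 2).const_mul C).div_const 2)).congr_deriv ?_
    simp
    ring
  have hm : AntitoneOn (fun s => J s - C * s ^ 2 / 2) (Set.Ici 0) := by
    apply antitoneOn_of_deriv_nonpos (convex_Ici 0)
    · exact fun s _ => (hd s).continuousAt.continuousWithinAt
    · exact fun s _ => (hd s).differentiableAt.differentiableWithinAt
    · intro s hs
      rw [interior_Ici] at hs
      rw [(hd s).deriv]
      have := J_le h hρ hf hf1 (s := s) (le_of_lt hs)
      linarith
  have := hm (Set.mem_Ici.2 le_rfl) (Set.mem_Ici.2 zero_le_one) zero_le_one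
  simp [hJ] at this
  linarith

end bias
end PartH

section PartS
open MeasureTheory
open scoped ENNReal RealInnerProductSpace
variable {d : ℕ}

theorem smoothing {f : EV d → ℝ} (hf : LipschitzWith 1 f) {δ : ℝ} (hδ : 0 < δ) :
    ∃ g : EV d → ℝ, LipschitzWith 1 g ∧ ContDiff ℝ 1 g ∧ ∀ x, |g x - f x| ≤ δ := by
  let φ : ContDiffBump (0 : EV d) := ⟨δ / 2, δ, by positivity, by linarith⟩
  refine ⟨MeasureTheory.convolution (φ.normed volume) f (ContinuousLinearMap.lsmul ℝ ℝ) volume, ?_, ?_, ?_⟩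
  · have hi : ∀ x, Integrable (fun t => φ.normed volume t * f (x - t)) := by
      intro x
      have hc := hf.continuous
      have hc2 : Continuous (φ.normed volume) := φ.continuous_normed
      exact (by fun_prop : Continuous _).integrable_of_hasCompactSupport (φ.hasCompactSupport_normed.mul_right)
    have key : ∀ x y, (∫ t, φ.normed volume t * f (x - t)) - (∫ t, φ.normed volume t * f (y - t)) ≤ ‖x - y‖ := by
      intro x y
      rw [← integral_sub (hi x) (hi y)]
      calc _ ≤ ∫ t, φ.normed volume t * ‖x - y‖ := by
            refine integral_mono ((hi x).sub (hi y)) (φ.integrable_normed.mul_const _) fun t => ?_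
            have h1 := lip_abs hf (x - t) (y - t)
            rw [sub_sub_sub_cancel_right] at h1
            have h2 := φ.nonneg_normed (μ := volume) t
            have h3 := le_of_abs_le h1
            show φ.normed volume t * f (x - t) - φ.normed volume t * f (y - t) ≤ _
            rw [← mul_sub]
            gcongr
        _ = ‖x - y‖ := by rw [integral_mul_const, φ.integral_normed, one_mul]
    apply LipschitzWith.of_dist_le_mul
    intro x y
    rw [Real.dist_eq, abs_le]
    have k1 := key x y
    have k2 := key y x
    rw [norm_sub_rev] at k2
    simp only [convolution, ContinuousLinearMap.lsmul_apply, smul_eq_mul, NNReal.coe_one, one_mul, dist_eq_norm]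
    constructor <;> linarith
  · exact φ.hasCompactSupport_normed.contDiff_convolution_left _ φ.contDiff_normed hf.continuous.locallyIntegrable
  · intro x
    rw [← Real.dist_eq]
    refine ContDiffBump.dist_normed_convolution_le hf.continuous.aestronglyMeasurable fun y hy => ?_
    have := hf.dist_le_mul y x
    have h2 : dist y x < δ := hy
    simp at this
    linarith

section bias
variable {U : EV d → ℝ} {m M : ℝ} {θs : EV d} {ρ : ℝ}

theorem bias (h : Hyp U m M θs) (hρ : 0 < ρ) {f : EV d → ℝ} (hf : LipschitzWith 1 f) :
    ∫ x, f x ∂((gib U).bind (Gk ρ)) - ∫ x, f x ∂(gib U) ≤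
      min (ρ * Real.sqrt d) (ρ ^ 2 / 2 * Real.sqrt (d * M)) := by
  have hp := h.pot.prob
  have hp2 := (gp_pot0 (d := d) hρ).prob
  have hb : ∀ f : EV d → ℝ, LipschitzWith 1 f → ∫ x, f x ∂((gib U).bind (Gk ρ)) =
      ∫ p : EV d × EV d, f (p.1 + p.2) ∂((gib U).prod (gib (gp ρ))) := by
    intro f hf
    rw [((G_LK hρ).bind_aux h.pot.good f 1 hf).2]
    have := int_shift h.pot hρ hf 1
    simp only [one_smul] at this
    rw [integral_prod _ this]
    simp only [G_int hρ]
  have hb2 : ∀ f : EV d → ℝ, ∫ p : EV d × EV d, f p.1 ∂((gib U).prod (gib (gp ρ))) = ∫ x, f x ∂(gib U) := by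
    intro f
    rw [integral_fun_fst]
    simp
  apply le_min
  · rw [hb f hf, ← hb2 f]
    have i1 := int_shift h.pot hρ hf 1
    simp only [one_smul] at i1
    have i2 : Integrable (fun p : EV d × EV d => f p.1) ((gib U).prod (gib (gp ρ))) :=
      (h.pot.eg (EG.lip hf)).comp_fst _
    have i3 : Integrable (fun p : EV d × EV d => ‖p.2‖) ((gib U).prod (gib (gp ρ))) :=
      ((gp_pot0 hρ).eg EG.norm).comp_snd _
    rw [← integral_sub i1 i2]
    calc _ ≤ ∫ p : EV d × EV d, ‖p.2‖ ∂((gib U).prod (gib (gp ρ))) := by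
          refine integral_mono (i1.sub i2) i3 fun p => ?_
          have := le_of_abs_le (lip_abs hf (p.1 + p.2) p.1)
          rwa [add_sub_cancel_left] at this
      _ = ∫ ξ : EV d, ‖ξ‖ ∂(gib (gp ρ)) := by
          rw [integral_fun_snd (f := fun ξ : EV d => ‖ξ‖)]
          simp
      _ ≤ _ := gp_norm hρ
  · refine le_of_forall_pos_le_add fun δ hδ => ?_
    obtain ⟨g, g1, g2, g3⟩ := smoothing hf (δ := δ / 2) (by positivity)
    have k := bias_C1 h hρ g1 g2
    rw [← hb g g1, hb2 g] at k
    have comp : ∀ μ : Measure (EV d), Good μ → |∫ x, g x ∂μ - ∫ x, f x ∂μ| ≤ δ / 2 := by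
      intro μ hμ
      have := hμ.1
      rw [← integral_sub (hμ.lip g1) (hμ.lip hf)]
      have := norm_integral_le_of_norm_le_const (μ := μ) (f := fun x => g x - f x) (C := δ / 2) (Filter.Eventually.of_forall g3)
      simpa using this
    have c1 := abs_le.1 (comp _ h.pot.good)
    have c2 := abs_le.1 (comp _ ((G_LK hρ).bind_good h.pot.good))
    linarith [c1.1, c1.2, c2.1, c2.2]
end bias

end PartS

section PartT
open MeasureTheory
open scoped ENNReal RealInnerProductSpace
variable {d : ℕ}

theorem iter_good {P : EV d → Measure (EV d)} {L : NNReal} (hP : LK P L) {μ : Measure (EV d)} (hμ : Good μ) (t : ℕ) :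
    Good (iterDist P μ t) := by
  induction t with
  | zero => exact hμ
  | succ t ih => exact hP.bind_good ih

theorem dirac_good (x : EV d) : Good (Measure.dirac x) :=
  ⟨inferInstance, integrable_dirac (by simp)⟩

theorem iter_contr {P : EV d → Measure (EV d)} {L : NNReal} (hP : LK P L) {ν : Measure (EV d)} (hν : Good ν)
    (hinv : ν.bind P = ν) (θs : EV d) (t : ℕ) : ∀ (f : EV d → ℝ) (K : NNReal), LipschitzWith K f →
      ∫ x, f x ∂(iterDist P (Measure.dirac θs) t) - ∫ x, f x ∂ν ≤ K * (L ^ t * ∫ x, ‖x - θs‖ ∂ν) := by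
  induction t with
  | zero =>
    intro f K hf
    have := hν.1
    have hl : LipschitzWith 1 (fun x : EV d => ‖x - θs‖) := by
      apply LipschitzWith.of_dist_le_mul
      intro x y
      rw [Real.dist_eq]
      have := abs_norm_sub_norm_le (x - θs) (y - θs)
      rw [sub_sub_sub_cancel_right] at this
      simpa [dist_eq_norm] using this
    rw [iterDist, integral_dirac, pow_zero, one_mul, ← integral_const_mul]
    have e : f θs = ∫ _x : EV d, f θs ∂ν := by simp
    rw [e, ← integral_sub (integrable_const _) (hν.lip hf)]
    refine integral_mono ((integrable_const _).sub (hν.lip hf)) ((hν.lip hl).const_mul _) fun x => ?_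
    have := hf.dist_le_mul θs x
    rw [dist_comm θs x, dist_eq_norm x θs, Real.dist_eq] at this
    exact le_of_abs_le this
  | succ t ih =>
    intro f K hf
    have h1 := (hP.bind_aux (iter_good hP (dirac_good θs) t) f K hf).2
    have h2 := (hP.bind_aux hν f K hf).2
    rw [hinv] at h2
    rw [iterDist, h1, h2]
    refine (ih _ _ (hP.lip f K hf)).trans (le_of_eq ?_)
    push_cast
    ring

section main
variable {U : EV d → ℝ} {m M : ℝ} {θs : EV d} {ρ : ℝ}

theorem sgs_LK (h : Hyp U m M θs) (hρ : 0 < ρ) :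
    LK (sgsKernelId U ρ) (Real.toNNReal (1 / (1 + m * ρ ^ 2))) := by
  rw [sgs_eq]
  have := (K_LK h.hm h.pot h.sc hρ).comp (G_LK hρ)
  rwa [mul_one] at this

theorem sgs_inv (h : Hyp U m M θs) (hρ : 0 < ρ) :
    ((gib U).bind (Gk ρ)).bind (sgsKernelId U ρ) = (gib U).bind (Gk ρ) := by
  rw [sgs_eq, ← Measure.bind_bind, invariant h.pot hρ]
  · exact (K_LK h.hm h.pot h.sc hρ).meas.aemeasurable
  · exact (G_LK hρ).meas.aemeasurable

theorem first_moment (h : Hyp U m M θs) : ∫ x, ‖x - θs‖ ∂(gib U) ≤ Real.sqrt (d / m) := by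
  have := h.pot.prob
  have hl : EG (fun x : EV d => ‖x - θs‖) :=
    (EG.norm.add (EG.const ‖θs‖)).of_le (by fun_prop) fun z => by
      rw [abs_of_nonneg (norm_nonneg _)]; exact norm_sub_le _ _
  have h2 : EG (fun x : EV d => ‖x - θs‖ ^ 2) := by simpa [sq] using hl.mul hl
  exact cs_sqrt (h.pot.eg hl) (h.pot.eg h2) h.moment

theorem bias_val (hm : 0 < m) (hM : 0 < M) {ε : ℝ} (hε : 0 < ε) (hρ0 : 0 < ρ)
    (hρ : ρ ^ 2 = max (ε ^ 2 / (4 * m)) (ε / Real.sqrt (m * M))) :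
    min (ρ * Real.sqrt d) (ρ ^ 2 / 2 * Real.sqrt (d * M)) ≤ ε / 2 * Real.sqrt (d / m) := by
  rw [Real.sqrt_div (by positivity), Real.sqrt_mul (by positivity)]
  have s1 : 0 < Real.sqrt m := Real.sqrt_pos.2 hm
  have s2 : 0 < Real.sqrt M := Real.sqrt_pos.2 hM
  rcases max_choice (ε ^ 2 / (4 * m)) (ε / Real.sqrt (m * M)) with hc | hc
  · rw [hc] at hρ
    have e : ρ = ε / (2 * Real.sqrt m) := by
      rw [← sq_eq_sq₀ hρ0.le (by positivity), hρ, div_pow, mul_pow, Real.sq_sqrt hm.le]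
      norm_num
    refine (min_le_left _ _).trans (le_of_eq ?_)
    rw [e]; field_simp
  · rw [hc, Real.sqrt_mul hm.le] at hρ
    refine (min_le_right _ _).trans (le_of_eq ?_)
    rw [hρ]; field_simp

theorem rate_val (hm : 0 < m) (hM : 0 < M) {ε : ℝ} (hε : 0 < ε)
    (hρ : ρ ^ 2 = max (ε ^ 2 / (4 * m)) (ε / Real.sqrt (m * M))) (t : ℕ)
    (ht : Real.log (3 / ε) / Real.log (1 + max (ε ^ 2 / 4) (ε * Real.sqrt (m / M))) ≤ t) :
    (1 / (1 + m * ρ ^ 2)) ^ t ≤ ε / 3 := by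
  have s1 : 0 < Real.sqrt m := Real.sqrt_pos.2 hm
  have s2 : 0 < Real.sqrt M := Real.sqrt_pos.2 hM
  have e : m * ρ ^ 2 = max (ε ^ 2 / 4) (ε * Real.sqrt (m / M)) := by
    rw [hρ, mul_max_of_nonneg _ _ hm.le, Real.sqrt_div hm.le, Real.sqrt_mul hm.le]
    congr 1
    · field_simp
    · field_simp
      rw [Real.sq_sqrt hm.le]
  rw [← e] at ht
  have hp : 0 < m * ρ ^ 2 := by rw [e]; exact lt_max_of_lt_left (by positivity)
  have hl : 0 < Real.log (1 + m * ρ ^ 2) := Real.log_pos (by linarith)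
  rw [div_le_iff₀ hl, ← Real.log_pow, Real.log_le_log_iff (by positivity) (by positivity)] at ht
  rw [div_pow, one_pow, div_le_iff₀ (by positivity)]
  rw [div_le_iff₀ hε] at ht
  linarith

theorem total (h : Hyp U m M θs) (hM : 0 < M) {ε : ℝ} (hε : 0 < ε) (hε1 : ε ≤ 1) (hρ0 : 0 < ρ)
    (hρ : ρ ^ 2 = max (ε ^ 2 / (4 * m)) (ε / Real.sqrt (m * M))) (t : ℕ)
    (ht : Real.log (3 / ε) / Real.log (1 + max (ε ^ 2 / 4) (ε * Real.sqrt (m / M))) ≤ t)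
    {f : EV d → ℝ} (hf : LipschitzWith 1 f) :
    ∫ x, f x ∂(iterDist (sgsKernelId U ρ) (Measure.dirac θs) t) - ∫ x, f x ∂(gib U) ≤ ε * Real.sqrt (d / m) := by
  have hm := h.hm
  have hl : LipschitzWith 1 (fun x : EV d => ‖x - θs‖) := by
    apply LipschitzWith.of_dist_le_mul
    intro x y
    rw [Real.dist_eq]
    have := abs_norm_sub_norm_le (x - θs) (y - θs)
    rw [sub_sub_sub_cancel_right] at this
    simpa [dist_eq_norm] using this
  have hb := bias_val (d := d) hm hM hε hρ0 hρ
  have b1 := (bias h hρ0 hf).trans hb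
  have b2 := (bias h hρ0 hl).trans hb
  have b3 := first_moment h
  have b4 := iter_contr (sgs_LK h hρ0) ((G_LK hρ0).bind_good h.pot.good) (sgs_inv h hρ0) θs t f 1 hf
  have b5 := rate_val hm hM hε hρ t ht
  rw [Real.coe_toNNReal _ (by positivity), NNReal.coe_one, one_mul] at b4
  set S := Real.sqrt (d / m)
  have hS : 0 ≤ S := Real.sqrt_nonneg _
  set B := ∫ x, ‖x - θs‖ ∂((gib U).bind (Gk ρ))
  have hB0 : 0 ≤ B := integral_nonneg fun x => norm_nonneg _
  have hB : B ≤ 3 / 2 * S := by nlinarith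
  have : (1 / (1 + m * ρ ^ 2)) ^ t * B ≤ ε / 3 * (3 / 2 * S) := by gcongr
  linarith

theorem final (h : Hyp U m M θs) (hM : 0 < M) {ε : ℝ} (hε : 0 < ε) (hε1 : ε ≤ 1) (hρ0 : 0 < ρ)
    (hρ : ρ ^ 2 = max (ε ^ 2 / (4 * m)) (ε / Real.sqrt (m * M))) (t : ℕ)
    (ht : Real.log (3 / ε) / Real.log (1 + max (ε ^ 2 / 4) (ε * Real.sqrt (m / M))) ≤ t) :
    Wp 1 (fun x y => ‖x - y‖) (iterDist (sgsKernelId U ρ) (Measure.dirac θs) t) (gib U) ≤ ε * Real.sqrt (d / m) := by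
  refine le_of_forall_pos_le_add fun δ hδ => ?_
  obtain ⟨γ, g1, g2⟩ := kr _ _ (iter_good (sgs_LK h hρ0) (dirac_good θs) t) h.pot.good _
    (fun f hf => total h hM hε hε1 hρ0 hρ t ht hf) δ hδ
  refine le_trans ?_ g2
  unfold Wp
  apply csInf_le
  · refine ⟨0, ?_⟩
    rintro r ⟨γ, -, rfl⟩
    simp only [Real.rpow_one, div_one]
    exact integral_nonneg fun x => norm_nonneg _
  · exact ⟨γ, g1, by simp⟩
end main
end PartT

theorem stmt2 {d : ℕ} (hd : 0 < d) (U : EV d → ℝ) (m₁ M₁ : ℝ)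
    (hm : 0 < m₁) (hmM : m₁ ≤ M₁)
    -- (A0)
    (hA0bdd : BddBelow (Set.range U))
    (hA0int : Integrable fun z : EV d => Real.exp (-U z))
    -- (A2): U is C² and M₁-smooth
    (hC2 : ContDiff ℝ 2 U)
    (hHess : ∀ (z v : EV d), |⟪v, fderiv ℝ (gradient U) z v⟫| ≤ M₁ * ‖v‖ ^ 2)
    -- (A4): U is m₁-strongly convex
    (hsc : ConvexOn ℝ Set.univ fun z => U z - m₁ / 2 * ‖z‖ ^ 2)
    -- θ* is the minimizer of U
    (θstar : EV d) (hmin : ∀ θ, U θstar ≤ U θ)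
    (ε : ℝ) (hε0 : 0 < ε) (hε1 : ε ≤ 1)
    (ρ : ℝ) (hρpos : 0 < ρ)
    (hρ : ρ ^ 2 = max (ε ^ 2 / (4 * m₁)) (ε / Real.sqrt (m₁ * M₁)))
    (t : ℕ)
    (ht : Real.log (3 / ε) /
        Real.log (1 + max (ε ^ 2 / 4) (ε * Real.sqrt (m₁ / M₁))) ≤ t) :
    Wp 1 (fun x y => ‖x - y‖)
        (iterDist (sgsKernelId U ρ) (Measure.dirac θstar) t)
        (densMeasure fun θ : EV d => Real.exp (-U θ)) ≤
      ε * Real.sqrt (d / m₁) := by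
  have h : Hyp U m₁ M₁ θstar := ⟨hm, by linarith, hC2, hHess, hsc, hmin⟩
  exact final h (by linarith) hε0 hε1 hρpos hρ t ht

end
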